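/- The expectation of ln C(z) for z drawn from the adversarial measure μ satisfies E_μ[ln C] ≤ 2·ln n + ln d + ln(1/σ) + ln(13π/2) + (1/(1 - β/n)) · ln( 2·e·H²·n / ln(πn/2) ). -/

import Mathlib

open MeasureTheory Filter
open scoped RealInnerProductSpace ENNReal

/-- `I_m(σ) := ∫₀^σ r^{m-1} / √(1 - r²) dr`. -/
noncomputable def Ifun (m σ : ℝ) : ℝ :=
  ∫ r in (0:ℝ)..σ, r ^ (m - 1) / Real.sqrt (1 - r ^ 2)

/-- The spherical cap `{z ∈ Sⁿ : ⟨z,a⟩ > √(1-ρ²)}` in `Sⁿ ⊆ ℝ^{n+1}`. -/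
noncomputable def cap (n : ℕ) (a : EuclideanSpace ℝ (Fin (n + 1))) (ρ : ℝ) :
    Set (EuclideanSpace ℝ (Fin (n + 1))) :=
  {z | z ∈ Metric.sphere (0 : EuclideanSpace ℝ (Fin (n + 1))) 1 ∧
       Real.sqrt (1 - ρ ^ 2) < ⟪z, a⟫}

/-- `ν_{a,σ}`: the uniform probability measure on `cap(a,σ)`, i.e. the normalized
`n`-dimensional Hausdorff (surface) measure restricted to `cap(a,σ)`. -/
noncomputable def nuMeasure (n : ℕ) (a : EuclideanSpace ℝ (Fin (n + 1))) (σ : ℝ) :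
    Measure (EuclideanSpace ℝ (Fin (n + 1))) :=
  (μH[(n : ℝ)] (cap n a σ))⁻¹ • (μH[(n : ℝ)]).restrict (cap n a σ)

/-- `g(r) = C_{β,σ} · r^{-β} · h(r)` with `C_{β,σ} = I_n(σ)/I_{n-β}(σ)`. -/
noncomputable def gFun (n : ℕ) (σ β : ℝ) (h : ℝ → ℝ) (r : ℝ) : ℝ :=
  (Ifun n σ / Ifun ((n : ℝ) - β) σ) * r ^ (-β) * h r

/-- The adversarial measure: the density of `μ` with respect to `ν_{a,σ}` at `z` is
`f(z) = g(sin θ(z,a))`, where `sin θ(z,a) = √(1 - ⟨z,a⟩²)` for unit vectors `z, a`. -/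
noncomputable def advMeasure (n : ℕ) (a : EuclideanSpace ℝ (Fin (n + 1))) (σ β : ℝ)
    (h : ℝ → ℝ) : Measure (EuclideanSpace ℝ (Fin (n + 1))) :=
  (nuMeasure n a σ).withDensity
    (fun z => ENNReal.ofReal (gFun n σ β h (Real.sqrt (1 - ⟪z, a⟫ ^ 2))))

section LineIntegration

variable {E : Type*} [NormedAddCommGroup E] [InnerProductSpace ℝ E] [FiniteDimensional ℝ E]
  [MeasurableSpace E] [BorelSpace E]

/-- Lebesgue measure is disintegrated along the lines of direction `u`. -/
theorem lintegral_eq_lintegral_lines {u : E} (hu : ‖u‖ = 1) {F : E → ℝ≥0∞} (hF : Measurable F) :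
    ∫⁻ x, F x = ∫⁻ x in {x : E | ⟪x, u⟫ ∈ Set.Ico (0 : ℝ) 1}, ∫⁻ t : ℝ, F (x + t • u) := by
  have hT : MeasurableSet {x : E | ⟪x, u⟫ ∈ Set.Ico (0 : ℝ) 1} :=
    measurableSet_Ico.preimage (by fun_prop)
  set T : Set E := {x : E | ⟪x, u⟫ ∈ Set.Ico (0 : ℝ) 1} with hTdef
  have h1 : ∀ x : E, ∫⁻ t : ℝ, T.indicator 1 (x - t • u) = (1 : ℝ≥0∞) := by
    intro x
    have : (fun t : ℝ => T.indicator (1 : E → ℝ≥0∞) (x - t • u))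
        = (Set.Ioc (⟪x, u⟫ - 1) ⟪x, u⟫).indicator 1 := by
      funext t
      have : x - t • u ∈ T ↔ t ∈ Set.Ioc (⟪x, u⟫ - 1) ⟪x, u⟫ := by
        simp only [hTdef, Set.mem_ofPred_eq, inner_sub_left, real_inner_smul_left,
          real_inner_self_eq_norm_sq, hu, Set.mem_Ico, Set.mem_Ioc]
        constructor <;> rintro ⟨h1, h2⟩ <;> constructor <;> linarith
      by_cases h : x - t • u ∈ T
      · rw [Set.indicator_of_mem h, Set.indicator_of_mem (this.1 h)]; simp
      · rw [Set.indicator_of_notMem h, Set.indicator_of_notMem (fun h' => h (this.2 h'))]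
    rw [this, lintegral_indicator_one measurableSet_Ioc]
    simp
  have hind : Measurable (T.indicator (1 : E → ℝ≥0∞)) := measurable_one.indicator hT
  calc ∫⁻ x, F x = ∫⁻ x, ∫⁻ t : ℝ, F x * T.indicator 1 (x - t • u) := by
        refine lintegral_congr fun x => ?_
        have hm : Measurable fun t : ℝ => T.indicator (1 : E → ℝ≥0∞) (x - t • u) :=
          hind.comp (by fun_prop)
        rw [lintegral_const_mul _ hm, h1, mul_one]
    _ = ∫⁻ t : ℝ, ∫⁻ x, F x * T.indicator 1 (x - t • u) := by
        refine lintegral_lintegral_swap (Measurable.aemeasurable ?_)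
        exact (hF.comp measurable_fst).mul (hind.comp (by fun_prop))
    _ = ∫⁻ t : ℝ, ∫⁻ x, F (x + t • u) * T.indicator 1 x := by
        refine lintegral_congr fun t => ?_
        rw [← lintegral_add_right_eq_self _ (t • u)]
        simp
    _ = ∫⁻ x, ∫⁻ t : ℝ, F (x + t • u) * T.indicator 1 x := by
        refine lintegral_lintegral_swap (Measurable.aemeasurable ?_)
        exact (hF.comp (by fun_prop)).mul (hind.comp measurable_snd)
    _ = _ := by
        rw [← lintegral_indicator hT]
        refine lintegral_congr fun x => ?_
        by_cases h : x ∈ T <;> simp [h]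

theorem lintegral_le_of_forall_line_le {u : E} (hu : ‖u‖ = 1) {F G : E → ℝ≥0∞}
    (hF : Measurable F) (hG : Measurable G)
    (hFG : ∀ x, ∫⁻ t : ℝ, F (x + t • u) ≤ ∫⁻ t : ℝ, G (x + t • u)) :
    ∫⁻ x, F x ≤ ∫⁻ x, G x := by
  rw [lintegral_eq_lintegral_lines hu hF, lintegral_eq_lintegral_lines hu hG]
  exact lintegral_mono fun x => hFG x

end LineIntegration

section LogKernel

/-- The negative part of the logarithm of `|t|`, equal to `∞` at `0`. -/
noncomputable def negLog (t : ℝ) : ℝ≥0∞ :=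
  if t = 0 then ⊤ else ENNReal.ofReal (-Real.log |t|)

theorem measurable_negLog : Measurable negLog := by
  refine Measurable.ite (measurableSet_singleton 0) measurable_const ?_
  exact ENNReal.measurable_ofReal.comp
    (Real.measurable_log.comp (measurable_norm : Measurable fun t : ℝ => ‖t‖)).neg

theorem le_negLog {r t : ℝ} (hr : |t| ≤ r) : ENNReal.ofReal (-Real.log r) ≤ negLog t := by
  unfold negLog
  split_ifs with h
  · exact le_top
  · have := Real.log_le_log (abs_pos.2 h) hr
    exact ENNReal.ofReal_le_ofReal (by linarith)

theorem lintegral_negLog : ∫⁻ t, negLog t = 2 := by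
  have h0 : ∀ᵐ t : ℝ, negLog t =
      (Set.Ioc (-1 : ℝ) 1).indicator (fun t => ENNReal.ofReal (-Real.log t)) t := by
    have : ∀ᵐ t : ℝ, t ≠ 0 := by simp [ae_iff]
    filter_upwards [this] with t ht
    simp only [negLog, ht, if_false, Real.log_abs]
    by_cases h : t ∈ Set.Ioc (-1 : ℝ) 1
    · rw [Set.indicator_of_mem h]
    · rw [Set.indicator_of_notMem h, ENNReal.ofReal_eq_zero, ← Real.log_abs, neg_nonpos]
      refine Real.log_nonneg ?_
      by_contra h'
      push Not at h'
      exact h ⟨(abs_lt.1 h').1, (abs_lt.1 h').2.le⟩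
  rw [lintegral_congr_ae h0, lintegral_indicator measurableSet_Ioc]
  have hi : IntegrableOn (fun t : ℝ => -Real.log t) (Set.Ioc (-1) 1) := by
    have := (intervalIntegral.intervalIntegrable_log' (a := -1) (b := 1)).neg
    exact (intervalIntegrable_iff_integrableOn_Ioc_of_le (by norm_num)).1 this
  rw [← ofReal_integral_eq_lintegral_ofReal hi, ← intervalIntegral.integral_of_le (by norm_num)]
  · rw [intervalIntegral.integral_neg, integral_log]
    norm_num
  · refine (ae_restrict_iff' measurableSet_Ioc).2 (Eventually.of_forall fun t ht => ?_)
    have : Real.log |t| ≤ 0 := Real.log_nonpos (abs_nonneg _) (abs_le.2 ⟨ht.1.le, ht.2⟩)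
    simpa using this

theorem lintegral_negLog_affine {B : ℝ} (hB : 0 < B) (r : ℝ) :
    ∫⁻ t, negLog (B * (t - r)) = ENNReal.ofReal (2 / B) := by
  rw [lintegral_sub_right_eq_self (fun t => negLog (B * t)) r]
  have h1 : ∫⁻ t, negLog (B * t) = ∫⁻ t, negLog t ∂(Measure.map (fun t => B * t) volume) := by
    rw [lintegral_map measurable_negLog (by fun_prop)]
  rw [h1, Real.map_volume_mul_left hB.ne', lintegral_smul_measure, lintegral_negLog,
    abs_of_pos (inv_pos.2 hB), smul_eq_mul]
  rw [show (2 : ℝ≥0∞) = ENNReal.ofReal 2 by simp, ← ENNReal.ofReal_mul (inv_pos.2 hB).le]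
  congr 1
  field_simp

end LogKernel

section InverseSeries

open Polynomial in
/-- If all complex roots of `p` have modulus at least `R`, then the coefficients of `1 / p` grow
at most like `R ^ (-m)`, up to a polynomial factor. -/
theorem norm_coeff_inverse_le (d : ℕ) {R : ℝ} (hR : 0 < R) :
    ∀ (p : ℂ[X]) (b : PowerSeries ℂ), p.natDegree ≤ d → (p : PowerSeries ℂ) * b = 1 →
      (∀ z, p.IsRoot z → R ≤ ‖z‖) →
      ∀ m : ℕ, ‖p.coeff 0‖ * ‖PowerSeries.coeff m b‖ ≤ (m + 1 : ℝ) ^ d * (R ^ m)⁻¹ := by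
  induction d with
  | zero =>
    intro p b hp hpb _ m
    obtain ⟨c, rfl⟩ : ∃ c, p = C c := ⟨_, eq_C_of_natDegree_le_zero hp⟩
    have := congrArg (PowerSeries.coeff m) hpb
    rw [Polynomial.coe_C, PowerSeries.coeff_C_mul, PowerSeries.coeff_one] at this
    rw [coeff_C_zero, ← norm_mul, this]
    split_ifs with h
    · simp [h]
    · simp only [norm_zero]; positivity
  | succ d ih =>
    intro p b hp hpb hroot m
    have hp0 : p ≠ 0 := by rintro rfl; simp at hpb
    by_cases hdeg : p.natDegree ≤ d
    · refine (ih p b hdeg hpb hroot m).trans ?_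
      gcongr
      · linarith [(Nat.cast_nonneg m : (0 : ℝ) ≤ m)]
      · exact Nat.le_succ d
    obtain ⟨ρ, hρ⟩ := Complex.exists_root (by
      rw [degree_eq_natDegree hp0]; exact_mod_cast (by omega : 0 < p.natDegree))
    have hρR := hroot ρ hρ
    have hρ0 : ρ ≠ 0 := by rw [← norm_pos_iff]; linarith
    obtain ⟨q, rfl⟩ := dvd_iff_isRoot.2 hρ
    set q' : ℂ[X] := C (-ρ) * q with hq'
    have hfac : (X - C ρ) * q = (1 - C ρ⁻¹ * X) * q' := by
      have h1 : (C ρ⁻¹ * C ρ : ℂ[X]) = 1 := by rw [← C_mul, inv_mul_cancel₀ hρ0, C_1]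
      rw [hq', C_neg]
      linear_combination (-(X * q)) * h1
    set b' : PowerSeries ℂ := (((1 - C ρ⁻¹ * X : ℂ[X])) : PowerSeries ℂ) * b with hb'
    have hq0 : q ≠ 0 := right_ne_zero_of_mul hp0
    have hqd : q'.natDegree ≤ d := by
      have := natDegree_mul (X_sub_C_ne_zero ρ) hq0
      rw [natDegree_X_sub_C] at this
      have h2 : q'.natDegree ≤ q.natDegree := natDegree_C_mul_le (-ρ) q
      omega
    have hqb : (q' : PowerSeries ℂ) * b' = 1 := by
      rw [← hpb, hfac, hb', Polynomial.coe_mul (1 - C ρ⁻¹ * X) q']; ring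
    have hqroot : ∀ z, q'.IsRoot z → R ≤ ‖z‖ := by
      intro z hz
      refine hroot z ?_
      rw [hfac, IsRoot, eval_mul, hz.eq_zero, mul_zero]
    have hco : ((X - C ρ) * q).coeff 0 = q'.coeff 0 := by
      rw [hfac, mul_coeff_zero]; simp
    have key := ih q' b' hqd hqb hqroot
    rw [hco]
    have hrec0 : PowerSeries.coeff 0 b = PowerSeries.coeff 0 b' := by
      simp [hb']
    have hrec : ∀ k, PowerSeries.coeff (k + 1) b
        = PowerSeries.coeff (k + 1) b' + ρ⁻¹ * PowerSeries.coeff k b := by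
      intro k
      simp only [hb', Polynomial.coe_sub, Polynomial.coe_one, Polynomial.coe_mul,
        Polynomial.coe_C, Polynomial.coe_X, sub_mul, one_mul, map_sub, mul_assoc,
        PowerSeries.coeff_C_mul, PowerSeries.coeff_succ_X_mul]
      ring
    induction m with
    | zero => rw [hrec0]; simpa using key 0
    | succ m ihm =>
      have hle : ‖PowerSeries.coeff (m + 1) b‖
          ≤ ‖PowerSeries.coeff (m + 1) b'‖ + R⁻¹ * ‖PowerSeries.coeff m b‖ := by
        rw [hrec]
        refine (norm_add_le _ _).trans ?_
        rw [norm_mul, norm_inv]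
        gcongr
      have hk := key (m + 1)
      push_cast at hk ⊢
      calc ‖q'.coeff 0‖ * ‖PowerSeries.coeff (m + 1) b‖
          ≤ ‖q'.coeff 0‖ * (‖PowerSeries.coeff (m + 1) b'‖ + R⁻¹ * ‖PowerSeries.coeff m b‖) := by
            gcongr
        _ = ‖q'.coeff 0‖ * ‖PowerSeries.coeff (m + 1) b'‖
            + R⁻¹ * (‖q'.coeff 0‖ * ‖PowerSeries.coeff m b‖) := by ring
        _ ≤ (m + 1 + 1 : ℝ) ^ d * (R ^ (m + 1))⁻¹
            + R⁻¹ * ((m + 1 : ℝ) ^ (d + 1) * (R ^ m)⁻¹) := by gcongr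
        _ = ((m + 1 + 1 : ℝ) ^ d + (m + 1 : ℝ) ^ d * (m + 1)) * (R ^ (m + 1))⁻¹ := by
            rw [pow_succ R m, mul_inv, pow_succ (m + 1 : ℝ)]; ring
        _ ≤ ((m + 1 + 1 : ℝ) ^ d + (m + 1 + 1 : ℝ) ^ d * (m + 1)) * (R ^ (m + 1))⁻¹ := by
            gcongr; linarith
        _ = (m + 1 + 1 : ℝ) ^ (d + 1) * (R ^ (m + 1))⁻¹ := by ring

open Polynomial in
/-- The `t ^ j` coefficient of `p` is a polynomial of degree at most `j`, whose `j`-th coefficient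
is the `t ^ j` coefficient of `q`. -/
def IsGradedLift (p : PowerSeries ℂ[X]) (q : PowerSeries ℂ) : Prop :=
  ∀ j, (PowerSeries.coeff j p).natDegree ≤ j ∧
    (PowerSeries.coeff j p).coeff j = PowerSeries.coeff j q

namespace IsGradedLift

open Polynomial

theorem add {p p' : PowerSeries ℂ[X]} {q q' : PowerSeries ℂ} (h : IsGradedLift p q)
    (h' : IsGradedLift p' q') : IsGradedLift (p + p') (q + q') := fun j => by
  rw [map_add, map_add, coeff_add, (h j).2, (h' j).2]
  exact ⟨natDegree_add_le_of_degree_le (h j).1 (h' j).1, rfl⟩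

theorem mul {p p' : PowerSeries ℂ[X]} {q q' : PowerSeries ℂ} (h : IsGradedLift p q)
    (h' : IsGradedLift p' q') : IsGradedLift (p * p') (q * q') := fun j => by
  rw [PowerSeries.coeff_mul, PowerSeries.coeff_mul, finsetSum_coeff]
  constructor
  · refine natDegree_sum_le_of_forall_le _ _ fun x hx => ?_
    rw [Finset.HasAntidiagonal.mem_antidiagonal] at hx
    exact natDegree_mul_le.trans (hx ▸ add_le_add (h _).1 (h' _).1)
  · refine Finset.sum_congr rfl fun x hx => ?_
    rw [Finset.HasAntidiagonal.mem_antidiagonal] at hx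
    rw [← hx, coeff_mul_add_eq_of_natDegree_le (h _).1 (h' _).1, (h _).2, (h' _).2]

theorem const (c : ℂ) : IsGradedLift (PowerSeries.C (C c)) (PowerSeries.C c) := fun j => by
  rw [PowerSeries.coeff_C, PowerSeries.coeff_C]
  split_ifs with h <;> simp [h]

theorem X_mul_linear (v e : ℂ) :
    IsGradedLift (PowerSeries.X * PowerSeries.C (C v + X * C e))
      (PowerSeries.X * PowerSeries.C e) := fun j => by
  cases j with
  | zero => simp
  | succ j =>
    rw [PowerSeries.coeff_succ_X_mul, PowerSeries.coeff_succ_X_mul, PowerSeries.coeff_C,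
      PowerSeries.coeff_C]
    split_ifs with h
    · subst h
      constructor
      · compute_degree
      · simp [coeff_C]
    · simp

theorem inverse {p b : PowerSeries ℂ[X]} {q c : PowerSeries ℂ} {a : ℂ} (h : IsGradedLift p q)
    (ha : a ≠ 0) (hp0 : PowerSeries.coeff 0 p = C a) (hpb : p * b = 1) (hqc : q * c = 1) :
    IsGradedLift b c := by
  have hq0 : PowerSeries.coeff 0 q = a := by rw [← (h 0).2, hp0, coeff_C_zero]
  have hCa : (C a⁻¹ * C a : ℂ[X]) = 1 := by rw [← C_mul, inv_mul_cancel₀ ha, C_1]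
  intro j
  induction j using Nat.strong_induction_on with
  | _ j ih =>
    have hb := congrArg (fun f => C a⁻¹ * PowerSeries.coeff j f) hpb
    have hc := congrArg (fun f => a⁻¹ * PowerSeries.coeff j f) hqc
    simp only [PowerSeries.coeff_mul, PowerSeries.coeff_one] at hb hc
    rw [Finset.Nat.sum_antidiagonal_eq_sum_range_succ_mk, Finset.sum_range_succ'] at hb hc
    simp only [Nat.sub_zero, hp0, hq0] at hb hc
    have hb' : PowerSeries.coeff j b = C a⁻¹ * (if j = 0 then 1 else 0) - C a⁻¹ *
        ∑ x ∈ Finset.range j, PowerSeries.coeff (x + 1) p * PowerSeries.coeff (j - (x + 1)) b := by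
      rw [← hb]; linear_combination (-PowerSeries.coeff j b) * hCa
    have hc' : PowerSeries.coeff j c = a⁻¹ * (if j = 0 then 1 else 0) - a⁻¹ *
        ∑ x ∈ Finset.range j, PowerSeries.coeff (x + 1) q * PowerSeries.coeff (j - (x + 1)) c := by
      rw [← hc]; linear_combination (-PowerSeries.coeff j c) * (inv_mul_cancel₀ ha)
    rw [hb', hc']
    constructor
    · refine (natDegree_sub_le _ _).trans (max_le ?_ ?_)
      · split_ifs <;> simp
      · refine (natDegree_C_mul_le _ _).trans ?_
        refine natDegree_sum_le_of_forall_le _ _ fun x hx => ?_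
        rw [Finset.mem_range] at hx
        refine natDegree_mul_le.trans ?_
        have := (h (x + 1)).1
        have := (ih (j - (x + 1)) (by omega)).1
        omega
    · rw [coeff_sub, coeff_C_mul, coeff_C_mul, finsetSum_coeff]
      congr 2
      · split_ifs with h0 <;> simp [h0]
      · refine Finset.sum_congr rfl fun x hx => ?_
        rw [Finset.mem_range] at hx
        have hi := ih (j - (x + 1)) (by omega)
        rw [← (h (x + 1)).2, ← hi.2, ← coeff_mul_add_eq_of_natDegree_le (h (x + 1)).1 hi.1]
        congr 1
        omega

end IsGradedLift

/-- A power series whose inverse is a polynomial vanishing at `ε` cannot converge absolutely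
at `ε`. -/
theorem not_summable_inverse_of_isRoot {p : Polynomial ℂ} {b : PowerSeries ℂ} {ε : ℂ}
    (hpb : (p : PowerSeries ℂ) * b = 1) (hp : p.IsRoot ε) :
    ¬ Summable fun m => ‖PowerSeries.coeff m b * ε ^ m‖ := by
  intro hb
  have hp' : HasSum (fun m => p.coeff m * ε ^ m) (p.eval ε) := by
    rw [Polynomial.eval_eq_sum_range]
    refine hasSum_sum_of_ne_finset_zero fun m hm => ?_
    rw [Polynomial.coeff_eq_zero_of_natDegree_lt (by simpa using hm), zero_mul]
  have hpn : Summable fun m => ‖p.coeff m * ε ^ m‖ := by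
    refine summable_of_ne_finset_zero (s := Finset.range (p.natDegree + 1)) fun m hm => ?_
    rw [Polynomial.coeff_eq_zero_of_natDegree_lt (by simpa using hm), zero_mul, norm_zero]
  have h := tsum_mul_tsum_eq_tsum_sum_antidiagonal_of_summable_norm hpn hb
  rw [hp'.tsum_eq, hp.eq_zero, zero_mul] at h
  have h1 : ∀ m, ∑ kl ∈ Finset.HasAntidiagonal.antidiagonal m,
      p.coeff kl.1 * ε ^ kl.1 * (PowerSeries.coeff kl.2 b * ε ^ kl.2) = if m = 0 then 1 else 0 := by
    intro m
    have := congrArg (PowerSeries.coeff m) hpb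
    rw [PowerSeries.coeff_mul, PowerSeries.coeff_one] at this
    calc _ = (∑ kl ∈ Finset.HasAntidiagonal.antidiagonal m,
          PowerSeries.coeff kl.1 (p : PowerSeries ℂ) * PowerSeries.coeff kl.2 b) * ε ^ m := by
            rw [Finset.sum_mul]
            refine Finset.sum_congr rfl fun x hx => ?_
            rw [← Finset.HasAntidiagonal.mem_antidiagonal.1 hx, pow_add, Polynomial.coeff_coe]
            ring
      _ = _ := by rw [this]; split_ifs with h0 <;> simp [h0]
  simp only [h1] at h
  simp at h

end InverseSeries

section Gaussian

/-- The unnormalised standard Gaussian weight. -/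
noncomputable def gaussWeight {E : Type*} [NormedAddCommGroup E] (u : E) : ℝ≥0∞ :=
  ENNReal.ofReal (Real.exp (-‖u‖ ^ 2 / 2))

variable {E : Type*} [NormedAddCommGroup E] [InnerProductSpace ℝ E] [FiniteDimensional ℝ E]
  [MeasurableSpace E] [BorelSpace E]

omit [InnerProductSpace ℝ E] [FiniteDimensional ℝ E] in
theorem measurable_gaussWeight : Measurable (gaussWeight : E → ℝ≥0∞) := by
  unfold gaussWeight
  fun_prop

omit [FiniteDimensional ℝ E] [MeasurableSpace E] [BorelSpace E] in
theorem gaussWeight_line {e : E} (he : ‖e‖ = 1) (v : E) (s : ℝ) :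
    gaussWeight (v + s • e) = ENNReal.ofReal (Real.exp (-(‖v‖ ^ 2 - ⟪v, e⟫ ^ 2) / 2)) *
      ENNReal.ofReal (Real.exp (-(s + ⟪v, e⟫) ^ 2 / 2)) := by
  rw [gaussWeight, ← ENNReal.ofReal_mul (Real.exp_nonneg _), ← Real.exp_add, norm_add_sq_real,
    norm_smul, inner_smul_right, he, mul_one, Real.norm_eq_abs, sq_abs]
  congr 2
  ring

theorem gaussianPDF_standard (s : ℝ) : ProbabilityTheory.gaussianPDF 0 1 s =
    (ENNReal.ofReal (Real.sqrt (2 * Real.pi)))⁻¹ * ENNReal.ofReal (Real.exp (-s ^ 2 / 2)) := by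
  rw [ProbabilityTheory.gaussianPDF, ProbabilityTheory.gaussianPDFReal,
    ENNReal.ofReal_mul (by positivity), ← ENNReal.ofReal_inv_of_pos (by positivity)]
  simp

theorem lintegral_exp_neg_sq (c : ℝ) :
    ∫⁻ s : ℝ, ENNReal.ofReal (Real.exp (-(s + c) ^ 2 / 2)) =
      ENNReal.ofReal (Real.sqrt (2 * Real.pi)) := by
  rw [lintegral_add_right_eq_self (fun s : ℝ => ENNReal.ofReal (Real.exp (-s ^ 2 / 2))) c]
  have h1 := ProbabilityTheory.lintegral_gaussianPDF_eq_one 0 (one_ne_zero (α := NNReal))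
  simp_rw [gaussianPDF_standard] at h1
  rw [lintegral_const_mul _ (by fun_prop)] at h1
  exact (inv_inj.1 (ENNReal.eq_inv_of_mul_eq_one_left h1)).symm

theorem lintegral_exp_neg_sq_mul_sq (c : ℝ) :
    ∫⁻ s : ℝ, ENNReal.ofReal (Real.exp (-(s + c) ^ 2 / 2)) * ENNReal.ofReal ((s + c) ^ 2) =
      ENNReal.ofReal (Real.sqrt (2 * Real.pi)) := by
  rw [lintegral_add_right_eq_self
    (fun s : ℝ => ENNReal.ofReal (Real.exp (-s ^ 2 / 2)) * ENNReal.ofReal (s ^ 2)) c]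
  have hv := ProbabilityTheory.variance_id_gaussianReal (μ := 0) (v := 1)
  rw [ProbabilityTheory.variance_eq_integral aemeasurable_id] at hv
  simp only [id_eq, ProbabilityTheory.integral_id_gaussianReal, sub_zero] at hv
  have hi : Integrable (fun s : ℝ => s ^ 2) (ProbabilityTheory.gaussianReal 0 1) := by
    by_contra h
    rw [integral_undef h] at hv
    simp at hv
  have h1 := ofReal_integral_eq_lintegral_ofReal hi (ae_of_all _ fun s => sq_nonneg s)
  rw [hv, ProbabilityTheory.gaussianReal_of_var_ne_zero _ one_ne_zero,
    lintegral_withDensity_eq_lintegral_mul _ (ProbabilityTheory.measurable_gaussianPDF _ _)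
      (by fun_prop)] at h1
  simp_rw [Pi.mul_apply, gaussianPDF_standard, mul_assoc] at h1
  rw [lintegral_const_mul _ (by fun_prop), NNReal.coe_one, ENNReal.ofReal_one] at h1
  exact (inv_inj.1 (ENNReal.eq_inv_of_mul_eq_one_left h1.symm)).symm

theorem lintegral_gaussWeight_pos : (∫⁻ u : E, gaussWeight u) ≠ 0 := by
  rw [Ne, lintegral_eq_zero_iff measurable_gaussWeight]
  intro h
  have : ∀ᵐ u : E, False := h.mono fun u hu => by
    simp [gaussWeight, not_le.2 (Real.exp_pos _)] at hu
  rw [Filter.eventually_false_iff_eq_bot, ae_eq_bot] at this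
  exact (NeZero.ne (volume : Measure E)) this

theorem lintegral_gaussWeight_lt_top : (∫⁻ u : E, gaussWeight u) < ∞ := by
  have h := GaussianFourier.integral_rexp_neg_mul_sq_norm (V := E) (b := 1 / 2) (by norm_num)
  have hi : Integrable (fun u : E => Real.exp (-(1 / 2) * ‖u‖ ^ 2)) := by
    by_contra hi
    rw [integral_undef hi] at h
    have : 0 < (Real.pi / (1 / 2)) ^ (Module.finrank ℝ E / 2 : ℝ) := by positivity
    linarith
  have := hi.lintegral_lt_top
  simp only [gaussWeight]
  convert this using 5
  ring

theorem lintegral_gaussWeight_mul_inner_sq_le {e : E} (he : ‖e‖ = 1) :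
    ∫⁻ u, gaussWeight u * ENNReal.ofReal (⟪e, u⟫ ^ 2) ≤ ∫⁻ u : E, gaussWeight u := by
  refine lintegral_le_of_forall_line_le he (measurable_gaussWeight.mul (by fun_prop))
    measurable_gaussWeight fun v => le_of_eq ?_
  have hin : ∀ s : ℝ, ⟪e, v + s • e⟫ = s + ⟪v, e⟫ := fun s => by
    rw [inner_add_right, inner_smul_right, real_inner_self_eq_norm_sq, he, real_inner_comm]
    ring
  simp_rw [gaussWeight_line he, hin, mul_assoc]
  rw [lintegral_const_mul _ (by fun_prop), lintegral_const_mul _ (by fun_prop),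
    lintegral_exp_neg_sq, lintegral_exp_neg_sq_mul_sq]

theorem lintegral_gaussWeight_mul_norm_sq_le :
    ∫⁻ u : E, gaussWeight u * ENNReal.ofReal (‖u‖ ^ 2) ≤
      Module.finrank ℝ E * ∫⁻ u : E, gaussWeight u := by
  let b := stdOrthonormalBasis ℝ E
  have h : ∀ u : E, gaussWeight u * ENNReal.ofReal (‖u‖ ^ 2) =
      ∑ i, gaussWeight u * ENNReal.ofReal (⟪b i, u⟫ ^ 2) := fun u => by
    rw [← Finset.mul_sum, ← ENNReal.ofReal_sum_of_nonneg fun i _ => sq_nonneg _,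
      ← b.sum_sq_norm_inner_right u]
    simp
  have hm : ∀ i ∈ Finset.univ, Measurable fun u : E => gaussWeight u *
      ENNReal.ofReal (⟪b i, u⟫ ^ 2) := fun i _ => measurable_gaussWeight.mul (by fun_prop)
  simp_rw [h]
  rw [lintegral_finsetSum _ hm]
  refine (Finset.sum_le_card_nsmul _ _ _ fun i _ =>
    lintegral_gaussWeight_mul_inner_sq_le (b.orthonormal.1 i)).trans ?_
  simp

end Gaussian

section LineRestriction

open Polynomial

variable {N : ℕ}

/-- The restriction `τ ↦ Q (x + τ u)` of a multivariate polynomial to a complex line. -/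
noncomputable def lineRestriction (Q : MvPolynomial (Fin N) ℂ) (x u : EuclideanSpace ℝ (Fin N)) :
    ℂ[X] :=
  MvPolynomial.aeval (fun i => C (x i : ℂ) + X * C (u i : ℂ)) Q

/-- The restriction of `Q` to the lines through `x` with direction `v + s e`, as a power series
whose coefficients are polynomials in `s`. -/
noncomputable def lineRestrictionFamily (Q : MvPolynomial (Fin N) ℂ)
    (x v e : EuclideanSpace ℝ (Fin N)) : PowerSeries ℂ[X] :=
  MvPolynomial.eval₂ (PowerSeries.C.comp (C : ℂ →+* ℂ[X]))
    (fun i => PowerSeries.C (C (x i : ℂ)) +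
      PowerSeries.X * PowerSeries.C (C (v i : ℂ) + X * C (e i : ℂ))) Q

theorem eval_lineRestriction (Q : MvPolynomial (Fin N) ℂ) (x u : EuclideanSpace ℝ (Fin N))
    (τ : ℂ) : (lineRestriction Q x u).eval τ =
      MvPolynomial.eval (fun i => (x i : ℂ) + τ * (u i : ℂ)) Q := by
  induction Q using MvPolynomial.induction_on with
  | C c => simp [lineRestriction]
  | add p q hp hq => simp_all [lineRestriction]
  | mul_X p i hp =>
    simp_all [lineRestriction]
    exact .inl (mul_comm _ _)

theorem natDegree_lineRestriction_le (Q : MvPolynomial (Fin N) ℂ)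
    (x u : EuclideanSpace ℝ (Fin N)) : (lineRestriction Q x u).natDegree ≤ Q.totalDegree := by
  have := MvPolynomial.aeval_natDegree_le (m := Q.totalDegree) (n := 1) Q le_rfl
    (fun i => C (x i : ℂ) + X * C (u i : ℂ)) fun i => by compute_degree
  simpa [lineRestriction] using this

theorem map_lineRestrictionFamily (Q : MvPolynomial (Fin N) ℂ)
    (x v e : EuclideanSpace ℝ (Fin N)) (s : ℝ) :
    PowerSeries.map (evalRingHom (s : ℂ)) (lineRestrictionFamily Q x v e) =
      (lineRestriction Q x (v + s • e) : PowerSeries ℂ) := by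
  induction Q using MvPolynomial.induction_on with
  | C c => simp [lineRestrictionFamily, lineRestriction]
  | add p q hp hq => simp_all [lineRestrictionFamily, lineRestriction]
  | mul_X p i hp =>
    simp_all [lineRestrictionFamily, lineRestriction]
    exact .inl (mul_comm _ _)

theorem isGradedLift_lineRestrictionFamily (Q : MvPolynomial (Fin N) ℂ)
    (x v e : EuclideanSpace ℝ (Fin N)) :
    IsGradedLift (lineRestrictionFamily Q x v e) (lineRestriction Q x e : PowerSeries ℂ) := by
  induction Q using MvPolynomial.induction_on with
  | C c =>
    simpa [lineRestrictionFamily, lineRestriction] using IsGradedLift.const c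
  | add p q hp hq =>
    simpa [lineRestrictionFamily, lineRestriction] using hp.add hq
  | mul_X p i hp =>
    simpa [lineRestrictionFamily, lineRestriction,
      mul_comm PowerSeries.X (PowerSeries.C (e i : ℂ))] using
      hp.mul ((IsGradedLift.const (x i : ℂ)).add (IsGradedLift.X_mul_linear (v i : ℂ) (e i : ℂ)))

theorem coeff_zero_lineRestriction (Q : MvPolynomial (Fin N) ℂ)
    (x u : EuclideanSpace ℝ (Fin N)) :
    (lineRestriction Q x u).coeff 0 = MvPolynomial.eval (fun i => (x i : ℂ)) Q := by
  rw [coeff_zero_eq_eval_zero, eval_lineRestriction]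
  simp

theorem coeff_zero_lineRestrictionFamily (Q : MvPolynomial (Fin N) ℂ)
    (x v e : EuclideanSpace ℝ (Fin N)) :
    PowerSeries.coeff 0 (lineRestrictionFamily Q x v e) =
      C (MvPolynomial.eval (fun i => (x i : ℂ)) Q) := by
  induction Q using MvPolynomial.induction_on with
  | C c => simp [lineRestrictionFamily]
  | add p q hp hq => simp_all [lineRestrictionFamily]
  | mul_X p i hp => simp_all [lineRestrictionFamily]

/-- Large Taylor coefficients of `1 / Q (x + τ u)` force a complex zero `τ` of small modulus. -/
theorem ofReal_log_coeff_le {Q : MvPolynomial (Fin N) ℂ} {d : ℕ} (hd : Q.totalDegree ≤ d)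
    {x u : EuclideanSpace ℝ (Fin N)} {B : ℝ} (hB : 0 < B) {φ : ℝ≥0∞}
    (hx : MvPolynomial.eval (fun i => (x i : ℂ)) Q ≠ 0)
    (hφ : ∀ τ : ℂ, MvPolynomial.eval (fun i => (x i : ℂ) + τ * (u i : ℂ)) Q = 0 →
      ENNReal.ofReal (-Real.log (B * (‖τ‖ * ‖u‖))) ≤ φ)
    {b : PowerSeries ℂ} (hb : (lineRestriction Q x u : PowerSeries ℂ) * b = 1)
    {m : ℕ} (hm : m ≠ 0) (hbm : PowerSeries.coeff m b ≠ 0) :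
    ENNReal.ofReal (1 / m * Real.log (‖MvPolynomial.eval (fun i => (x i : ℂ)) Q‖ *
      ‖PowerSeries.coeff m b‖ / (m + 1) ^ d) - Real.log B - Real.log ‖u‖) ≤ φ := by
  set p := lineRestriction Q x u with hp
  have hp0 : p ≠ 0 := by
    intro h0
    rw [h0] at hb
    simp at hb
  have hroots : p.roots.toFinset.Nonempty := by
    by_contra hne
    rw [Finset.not_nonempty_iff_eq_empty, Multiset.toFinset_eq_empty] at hne
    have hdeg : p.natDegree = 0 := by
      rw [← (IsAlgClosed.splits p).natDegree_eq_card_roots.symm, hne, Multiset.card_zero]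
    rw [eq_C_of_natDegree_eq_zero hdeg] at hb
    have := congrArg (PowerSeries.coeff m) hb
    rw [Polynomial.coe_C, PowerSeries.coeff_C_mul, PowerSeries.coeff_one, if_neg hm,
      mul_eq_zero, coeff_zero_lineRestriction] at this
    tauto
  obtain ⟨τ, hτ, hmin⟩ := p.roots.toFinset.exists_min_image (fun z => ‖z‖) hroots
  rw [Multiset.mem_toFinset, mem_roots hp0] at hτ
  have hτ' : MvPolynomial.eval (fun i => (x i : ℂ) + τ * (u i : ℂ)) Q = 0 := by
    rw [← eval_lineRestriction]; exact hτ
  have hτ0 : 0 < ‖τ‖ := by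
    rw [norm_pos_iff]
    rintro rfl
    apply hx
    simpa using hτ'
  have hu0 : 0 < ‖u‖ := by
    rw [norm_pos_iff]
    rintro rfl
    apply hx
    simpa using hτ'
  have hkey := norm_coeff_inverse_le d hτ0 p b ((natDegree_lineRestriction_le Q x u).trans hd) hb
    (fun z hz => hmin z (by rw [Multiset.mem_toFinset, mem_roots hp0]; exact hz)) m
  rw [coeff_zero_lineRestriction] at hkey
  refine le_trans (ENNReal.ofReal_le_ofReal ?_) (hφ τ hτ')
  have hm' : (0 : ℝ) < m := by positivity
  have h1 : Real.log (‖MvPolynomial.eval (fun i => (x i : ℂ)) Q‖ *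
      ‖PowerSeries.coeff m b‖ / (m + 1) ^ d) ≤ -(m * Real.log ‖τ‖) := by
    rw [← Real.log_pow, ← Real.log_inv]
    refine Real.log_le_log (by positivity) ?_
    rw [div_le_iff₀ (by positivity), mul_comm _ ((m + 1 : ℝ) ^ d)]
    exact hkey
  have h2 : 1 / m * Real.log (‖MvPolynomial.eval (fun i => (x i : ℂ)) Q‖ *
      ‖PowerSeries.coeff m b‖ / (m + 1) ^ d) ≤ -Real.log ‖τ‖ := by
    rw [one_div, inv_mul_le_iff₀ hm']
    linarith
  rw [Real.log_mul hB.ne' (by positivity), Real.log_mul hτ0.ne' hu0.ne']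
  linarith

end LineRestriction

section RootPotential

theorem ofReal_neg_log_prod_le (M : Multiset ℂ) (s : ℝ) (hs : ∀ r ∈ M, (s : ℂ) ≠ r) :
    ENNReal.ofReal (-Real.log ‖(M.map fun r => (s : ℂ) - r).prod‖) ≤
      (M.map fun r => negLog (s - r.re)).sum := by
  induction M using Multiset.induction_on with
  | empty => simp
  | cons r M ih =>
    have hr : (s : ℂ) - r ≠ 0 := sub_ne_zero.2 (hs r (Multiset.mem_cons_self r M))
    have hM : (M.map fun r => (s : ℂ) - r).prod ≠ 0 := by
      rw [Ne, Multiset.prod_eq_zero_iff, Multiset.mem_map]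
      rintro ⟨r', hr', h0⟩
      exact hs r' (Multiset.mem_cons_of_mem hr') (sub_eq_zero.1 h0)
    rw [Multiset.map_cons, Multiset.prod_cons, Multiset.map_cons, Multiset.sum_cons, norm_mul,
      Real.log_mul (norm_ne_zero_iff.2 hr) (norm_ne_zero_iff.2 hM), neg_add]
    refine ENNReal.ofReal_add_le.trans (add_le_add (le_negLog ?_)
      (ih fun r' hr' => hs r' (Multiset.mem_cons_of_mem hr')))
    simpa using Complex.abs_re_le_norm ((s : ℂ) - r)

theorem sum_negLog_eq_top {M : Multiset ℂ} {s : ℝ} {r : ℂ} (hr : r ∈ M) (h : (s : ℂ) = r) :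
    (M.map fun r => negLog (s - r.re)).sum = ∞ := by
  obtain ⟨M', rfl⟩ := Multiset.exists_cons_of_mem hr
  subst h
  simp [negLog]

theorem measurable_sum_negLog (B : ℝ) (M : Multiset ℂ) :
    Measurable fun s : ℝ => (M.map fun r => negLog (B * (s - r.re))).sum := by
  induction M using Multiset.induction_on with
  | empty => simp
  | cons r M ih =>
    simp only [Multiset.map_cons, Multiset.sum_cons]
    exact (measurable_negLog.comp (by fun_prop)).add ih

theorem lintegral_sum_negLog {B : ℝ} (hB : 0 < B) (M : Multiset ℂ) :
    ∫⁻ s : ℝ, (M.map fun r => negLog (B * (s - r.re))).sum = M.card * ENNReal.ofReal (2 / B) := by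
  induction M using Multiset.induction_on with
  | empty => simp
  | cons r M ih =>
    have hm : Measurable fun s : ℝ => negLog (B * (s - r.re)) :=
      measurable_negLog.comp (by fun_prop)
    simp only [Multiset.map_cons, Multiset.sum_cons]
    rw [lintegral_add_left hm, ih, lintegral_negLog_affine hB, Multiset.card_cons]
    push_cast
    ring

end RootPotential

section DirectionBound

variable {N : ℕ}

theorem exists_roots_forall_le [NeZero N] {Q : MvPolynomial (Fin N) ℂ} {d : ℕ}
    (hd : Q.totalDegree ≤ d) {x : EuclideanSpace ℝ (Fin N)} {B : ℝ} (hB : 0 < B)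
    {φ : EuclideanSpace ℝ (Fin N) → ℝ≥0∞}
    (hx : MvPolynomial.eval (fun i => (x i : ℂ)) Q ≠ 0)
    (hφ : ∀ (u : EuclideanSpace ℝ (Fin N)) (τ : ℂ),
      MvPolynomial.eval (fun i => (x i : ℂ) + τ * (u i : ℂ)) Q = 0 →
      ENNReal.ofReal (-Real.log (B * (‖τ‖ * ‖u‖))) ≤ φ u)
    (v e : EuclideanSpace ℝ (Fin N))
    {c : PowerSeries ℂ} (hc : (lineRestriction Q x e : PowerSeries ℂ) * c = 1)
    {m : ℕ} (hm : m ≠ 0) (hcm : PowerSeries.coeff m c ≠ 0) :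
    ∃ M : Multiset ℂ, M.card = m ∧ ∀ s : ℝ,
      ENNReal.ofReal (1 / m * Real.log (‖MvPolynomial.eval (fun i => (x i : ℂ)) Q‖ *
        ‖PowerSeries.coeff m c‖ / (m + 1) ^ d) - Real.log B - Real.log N / 2 + 1 / 2) ≤
      φ (v + s • e) + ENNReal.ofReal (‖v + s • e‖ ^ 2 / (2 * N)) +
        ENNReal.ofReal (1 / m) * (M.map fun r => negLog (1 * (s - r.re))).sum := by
  set p0 := MvPolynomial.eval (fun i => (x i : ℂ)) Q with hp0
  set F := lineRestrictionFamily Q x v e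
  let w : (Polynomial ℂ)ˣ := Units.map Polynomial.C.toMonoidHom (Units.mk0 p0 hx)
  set b := PowerSeries.invOfUnit F w
  have hFb : F * b = 1 := by
    refine PowerSeries.mul_invOfUnit F w ?_
    rw [← PowerSeries.coeff_zero_eq_constantCoeff_apply, coeff_zero_lineRestrictionFamily]
    rfl
  obtain ⟨hdeg, hlead⟩ := (isGradedLift_lineRestrictionFamily Q x v e).inverse hx
    (coeff_zero_lineRestrictionFamily Q x v e) hFb hc m
  set q := PowerSeries.coeff m b
  have hq : q.natDegree = m :=
    le_antisymm hdeg (Polynomial.le_natDegree_of_ne_zero (by rwa [hlead]))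
  have hlc : q.leadingCoeff = PowerSeries.coeff m c := by rw [← hlead, ← hq]; rfl
  have hsplit := IsAlgClosed.splits q
  refine ⟨q.roots, by rw [← hsplit.natDegree_eq_card_roots, hq], fun s => ?_⟩
  have hm' : (0 : ℝ) < m := by positivity
  by_cases hs : ∃ r ∈ q.roots, (s : ℂ) = r
  · obtain ⟨r, hr, hsr⟩ := hs
    simp only [one_mul]
    rw [sum_negLog_eq_top hr hsr, ENNReal.mul_top (by simpa using hm), add_top]
    exact le_top
  push Not at hs
  set u := v + s • e with hu
  set b' := PowerSeries.map (Polynomial.evalRingHom (s : ℂ)) b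
  have hb' : (lineRestriction Q x u : PowerSeries ℂ) * b' = 1 := by
    rw [← map_lineRestrictionFamily, ← map_mul, hFb, map_one]
  have hcoeff : PowerSeries.coeff m b' = PowerSeries.coeff m c *
      (q.roots.map fun r => (s : ℂ) - r).prod := by
    rw [PowerSeries.coeff_map, Polynomial.coe_evalRingHom, hsplit.eval_eq_prod_roots, hlc]
  have hprod : (q.roots.map fun r => (s : ℂ) - r).prod ≠ 0 := by
    rw [Ne, Multiset.prod_eq_zero_iff, Multiset.mem_map]
    rintro ⟨r, hr, h0⟩
    exact hs r hr (sub_eq_zero.1 h0)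
  have hb'm : PowerSeries.coeff m b' ≠ 0 := by rw [hcoeff]; exact mul_ne_zero hcm hprod
  have h1 := ofReal_log_coeff_le hd hB hx (hφ u) hb' hm hb'm
  have h2 := ofReal_neg_log_prod_le q.roots s hs
  have hu0 : 0 < ‖u‖ := by
    rw [norm_pos_iff]
    intro h0
    have hconst : (lineRestriction Q x u : PowerSeries ℂ) = PowerSeries.C p0 := by
      have hC : ∀ R : MvPolynomial (Fin N) ℂ, lineRestriction R x u =
          Polynomial.C (MvPolynomial.eval (fun i => (x i : ℂ)) R) := by
        intro R
        refine Polynomial.funext fun τ => ?_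
        rw [eval_lineRestriction, h0]
        simp
      rw [hC, Polynomial.coe_C]
    have := congrArg (PowerSeries.coeff m) hb'
    rw [hconst, PowerSeries.coeff_C_mul, PowerSeries.coeff_one, if_neg hm, mul_eq_zero] at this
    tauto
  have hN : (0 : ℝ) < N := by exact_mod_cast NeZero.pos N
  have hlogu : Real.log ‖u‖ ≤ (Real.log N - 1 + ‖u‖ ^ 2 / N) / 2 := by
    have := Real.log_le_sub_one_of_pos (x := ‖u‖ ^ 2 / N) (by positivity)
    rw [Real.log_div (by positivity) hN.ne', Real.log_pow] at this
    push_cast at this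
    linarith
  have hlogc : Real.log (‖p0‖ * ‖PowerSeries.coeff m b'‖ / (m + 1) ^ d) =
      Real.log (‖p0‖ * ‖PowerSeries.coeff m c‖ / (m + 1) ^ d) +
        Real.log ‖(q.roots.map fun r => (s : ℂ) - r).prod‖ := by
    have hp0' : p0 ≠ 0 := hx
    rw [← Real.log_mul (by positivity) (norm_ne_zero_iff.2 hprod), hcoeff, norm_mul]
    ring_nf
  calc _ ≤ ENNReal.ofReal ((1 / m * Real.log (‖p0‖ * ‖PowerSeries.coeff m b'‖ / (m + 1) ^ d) -
        Real.log B - Real.log ‖u‖) + ‖u‖ ^ 2 / (2 * N) +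
        1 / m * (-Real.log ‖(q.roots.map fun r => (s : ℂ) - r).prod‖)) := by
        refine ENNReal.ofReal_le_ofReal ?_
        rw [hlogc]
        have : ‖u‖ ^ 2 / (2 * N) = ‖u‖ ^ 2 / N / 2 := by field_simp
        rw [this]
        linarith
    _ ≤ _ := by
        refine ENNReal.ofReal_add_le.trans (add_le_add (ENNReal.ofReal_add_le.trans ?_) ?_)
        · gcongr
        · rw [ENNReal.ofReal_mul (by positivity)]
          simp only [one_mul]
          gcongr

theorem ofReal_log_coeff_mul_le_lintegral [NeZero N] {Q : MvPolynomial (Fin N) ℂ} {d : ℕ}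
    (hd : Q.totalDegree ≤ d) {x : EuclideanSpace ℝ (Fin N)} {B : ℝ} (hB : 0 < B)
    {φ : EuclideanSpace ℝ (Fin N) → ℝ≥0∞} (hφm : Measurable φ)
    (hx : MvPolynomial.eval (fun i => (x i : ℂ)) Q ≠ 0)
    (hφ : ∀ (u : EuclideanSpace ℝ (Fin N)) (τ : ℂ),
      MvPolynomial.eval (fun i => (x i : ℂ) + τ * (u i : ℂ)) Q = 0 →
      ENNReal.ofReal (-Real.log (B * (‖τ‖ * ‖u‖))) ≤ φ u)
    {e : EuclideanSpace ℝ (Fin N)} (he : ‖e‖ = 1)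
    {c : PowerSeries ℂ} (hc : (lineRestriction Q x e : PowerSeries ℂ) * c = 1)
    {m : ℕ} (hm : m ≠ 0) (hcm : PowerSeries.coeff m c ≠ 0) :
    ENNReal.ofReal (1 / m * Real.log (‖MvPolynomial.eval (fun i => (x i : ℂ)) Q‖ *
        ‖PowerSeries.coeff m c‖ / (m + 1) ^ d) - Real.log B - Real.log N / 2 + 1 / 2) *
        (∫⁻ u : EuclideanSpace ℝ (Fin N), gaussWeight u) ≤
      (∫⁻ u, gaussWeight u * φ u) +
        ENNReal.ofReal (13 / 10) * ∫⁻ u : EuclideanSpace ℝ (Fin N), gaussWeight u := by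
  have hN : (0 : ℝ) < N := by exact_mod_cast NeZero.pos N
  set K := 1 / m * Real.log (‖MvPolynomial.eval (fun i => (x i : ℂ)) Q‖ *
        ‖PowerSeries.coeff m c‖ / (m + 1) ^ d) - Real.log B - Real.log N / 2 + 1 / 2
  have hg := measurable_gaussWeight (E := EuclideanSpace ℝ (Fin N))
  have hψ : Measurable fun u : EuclideanSpace ℝ (Fin N) =>
    φ u + ENNReal.ofReal (‖u‖ ^ 2 / (2 * N)) := hφm.add (by fun_prop)
  have hline : ∀ s : EuclideanSpace ℝ (Fin N), Measurable fun t : ℝ => s + t • e :=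
    fun s => by fun_prop
  have hmain : ENNReal.ofReal K * (∫⁻ u : EuclideanSpace ℝ (Fin N), gaussWeight u) ≤
      ∫⁻ u, gaussWeight u * (φ u + ENNReal.ofReal (‖u‖ ^ 2 / (2 * N)) +
        ENNReal.ofReal (4 / 5)) := by
    rw [← lintegral_const_mul _ hg]
    refine lintegral_le_of_forall_line_le he (hg.const_mul _)
      (hg.mul (hψ.add measurable_const)) fun v => ?_
    obtain ⟨M, hM, hle⟩ := exists_roots_forall_le hd hB hx hφ v e hc hm hcm
    set A := ENNReal.ofReal (Real.exp (-(‖v‖ ^ 2 - ⟪v, e⟫ ^ 2) / 2)) with hA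
    have hgA : ∀ s : ℝ, gaussWeight (v + s • e) ≤ A := fun s => by
      rw [gaussWeight_line he]
      refine mul_le_of_le_one_right' ?_
      rw [ENNReal.ofReal_le_one, Real.exp_le_one_iff]
      have := sq_nonneg (s + ⟪v, e⟫)
      linarith
    have hneg := measurable_sum_negLog 1 M
    have hint : ∫⁻ s : ℝ, gaussWeight (v + s • e) *
        (ENNReal.ofReal (1 / m) * (M.map fun r => negLog (1 * (s - r.re))).sum) ≤
        ∫⁻ s : ℝ, gaussWeight (v + s • e) * ENNReal.ofReal (4 / 5) := by
      have h1 : ∫⁻ s : ℝ, gaussWeight (v + s • e) * ENNReal.ofReal (4 / 5) =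
          A * (ENNReal.ofReal (Real.sqrt (2 * Real.pi)) * ENNReal.ofReal (4 / 5)) := by
        simp_rw [gaussWeight_line he, mul_assoc]
        rw [lintegral_const_mul _ (by fun_prop), lintegral_mul_const _ (by fun_prop),
          lintegral_exp_neg_sq]
      rw [h1]
      refine (lintegral_mono fun s => mul_le_mul_left (hgA s) _).trans ?_
      rw [lintegral_const_mul _ (hneg.const_mul _), lintegral_const_mul _ hneg,
        lintegral_sum_negLog one_pos, hM, ← ENNReal.ofReal_mul (by positivity),
        ← ENNReal.ofReal_natCast, ← ENNReal.ofReal_mul (by positivity),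
        ← ENNReal.ofReal_mul (by positivity)]
      refine mul_le_mul_right (ENNReal.ofReal_le_ofReal ?_) _
      have h2 : (5 / 2 : ℝ) ≤ Real.sqrt (2 * Real.pi) := by
        refine Real.le_sqrt_of_sq_le ?_
        have := Real.pi_gt_d2
        norm_num
        linarith
      have hm' : (m : ℝ) ≠ 0 := by exact_mod_cast hm
      field_simp
      linarith
    calc ∫⁻ s : ℝ, ENNReal.ofReal K * gaussWeight (v + s • e)
        ≤ ∫⁻ s : ℝ, (gaussWeight (v + s • e) *
          (φ (v + s • e) + ENNReal.ofReal (‖v + s • e‖ ^ 2 / (2 * N))) +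
          gaussWeight (v + s • e) *
          (ENNReal.ofReal (1 / m) * (M.map fun r => negLog (1 * (s - r.re))).sum)) := by
          refine lintegral_mono fun s => ?_
          rw [mul_comm, ← mul_add]
          exact mul_le_mul_right (hle s) _
      _ ≤ ∫⁻ s : ℝ, (gaussWeight (v + s • e) *
          (φ (v + s • e) + ENNReal.ofReal (‖v + s • e‖ ^ 2 / (2 * N))) +
          gaussWeight (v + s • e) * ENNReal.ofReal (4 / 5)) := by
          have hm1 : Measurable fun s : ℝ => gaussWeight (v + s • e) *
            (φ (v + s • e) + ENNReal.ofReal (‖v + s • e‖ ^ 2 / (2 * N))) :=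
            (hg.comp (hline v)).mul (hψ.comp (hline v))
          rw [lintegral_add_left hm1, lintegral_add_left hm1]
          gcongr
      _ = _ := by simp_rw [mul_add]
  refine hmain.trans ?_
  have hm1 : Measurable fun u : EuclideanSpace ℝ (Fin N) => gaussWeight u * φ u := hg.mul hφm
  have hm2 : Measurable fun u : EuclideanSpace ℝ (Fin N) =>
    gaussWeight u * ENNReal.ofReal (‖u‖ ^ 2 / (2 * N)) := hg.mul (by fun_prop)
  simp_rw [mul_add]
  have hm12 : Measurable fun u : EuclideanSpace ℝ (Fin N) => gaussWeight u * φ u +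
    gaussWeight u * ENNReal.ofReal (‖u‖ ^ 2 / (2 * N)) := hm1.add hm2
  rw [lintegral_add_left hm12, lintegral_add_left hm1, lintegral_mul_const _ hg,
    add_assoc]
  gcongr
  have h3 : ∫⁻ u : EuclideanSpace ℝ (Fin N),
      gaussWeight u * ENNReal.ofReal (‖u‖ ^ 2 / (2 * N)) ≤
      ENNReal.ofReal (1 / 2) * ∫⁻ u : EuclideanSpace ℝ (Fin N), gaussWeight u := by
    have h4 : ∀ u : EuclideanSpace ℝ (Fin N), gaussWeight u * ENNReal.ofReal (‖u‖ ^ 2 / (2 * N)) =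
        ENNReal.ofReal (1 / (2 * N)) * (gaussWeight u * ENNReal.ofReal (‖u‖ ^ 2)) := fun u => by
      rw [mul_left_comm, ← ENNReal.ofReal_mul (by positivity)]
      congr 2
      ring
    have hm3 : Measurable fun u : EuclideanSpace ℝ (Fin N) =>
      gaussWeight u * ENNReal.ofReal (‖u‖ ^ 2) := hg.mul (by fun_prop)
    simp_rw [h4]
    rw [lintegral_const_mul _ hm3]
    refine (mul_le_mul_right lintegral_gaussWeight_mul_norm_sq_le _).trans (le_of_eq ?_)
    rw [← mul_assoc, finrank_euclideanSpace, Fintype.card_fin, ← ENNReal.ofReal_natCast,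
      ← ENNReal.ofReal_mul (by positivity)]
    congr 2
    field_simp
  refine (add_le_add h3 le_rfl).trans (le_of_eq ?_)
  rw [mul_comm _ (ENNReal.ofReal (4 / 5)), ← add_mul, ← ENNReal.ofReal_add (by norm_num)
    (by norm_num)]
  norm_num

theorem summable_norm_mul_pow {c : PowerSeries ℂ} {p0 : ℂ} {d : ℕ} {A ε : ℝ} (hp0 : p0 ≠ 0)
    (hε : 0 < ε) (hA : Real.exp A * ε < 1)
    (hc : ∀ m : ℕ, m ≠ 0 → ‖p0‖ * ‖PowerSeries.coeff m c‖ ≤ (m + 1 : ℝ) ^ d * Real.exp A ^ m) :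
    Summable fun m => ‖PowerSeries.coeff m c * (ε : ℂ) ^ m‖ := by
  set ρ := Real.exp A * ε with hρ
  have hρ0 : 0 < ρ := by positivity
  have hp0' : 0 < ‖p0‖ := norm_pos_iff.2 hp0
  have hsum := (summable_pow_mul_geometric_of_norm_lt_one (R := ℝ) d (r := ρ)
    (by rwa [Real.norm_of_nonneg hρ0.le]))
  rw [← summable_nat_add_iff 1]
  refine Summable.of_nonneg_of_le (fun m => norm_nonneg _) (fun m => ?_)
    (((summable_nat_add_iff 2).2 hsum).mul_left (‖p0‖⁻¹ * ρ⁻¹))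
  have h1 := mul_le_mul_of_nonneg_right (hc (m + 1) (Nat.succ_ne_zero m))
    (pow_nonneg hε.le (m + 1))
  rw [norm_mul, norm_pow, Complex.norm_real, Real.norm_of_nonneg hε.le, mul_assoc,
    ← div_eq_inv_mul, le_div_iff₀' hp0', ← mul_assoc]
  refine h1.trans (le_of_eq ?_)
  rw [mul_assoc, ← mul_pow, ← hρ]
  push_cast
  field_simp
  ring

/-- If `Q` vanishes at a point at distance `ε` from `x`, then along a random Gaussian direction `u`
the polynomial `τ ↦ Q (x + τ u)` has a zero whose modulus is, in logarithmic mean, not much larger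
than `ε √N / ‖u‖`. -/
theorem ofReal_neg_log_dist_mul_le_lintegral [NeZero N] {Q : MvPolynomial (Fin N) ℂ}
    {x y : EuclideanSpace ℝ (Fin N)} {B : ℝ} (hB : 0 < B)
    {φ : EuclideanSpace ℝ (Fin N) → ℝ≥0∞} (hφm : Measurable φ)
    (hx : MvPolynomial.eval (fun i => (x i : ℂ)) Q ≠ 0)
    (hy : MvPolynomial.eval (fun i => (y i : ℂ)) Q = 0)
    (hφ : ∀ (u : EuclideanSpace ℝ (Fin N)) (τ : ℂ),
      MvPolynomial.eval (fun i => (x i : ℂ) + τ * (u i : ℂ)) Q = 0 →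
      ENNReal.ofReal (-Real.log (B * (‖τ‖ * ‖u‖))) ≤ φ u) :
    ENNReal.ofReal (-Real.log ‖y - x‖ - (Real.log B + Real.log N / 2 + 4 / 5)) *
        (∫⁻ u : EuclideanSpace ℝ (Fin N), gaussWeight u) ≤ ∫⁻ u, gaussWeight u * φ u := by
  set W := ∫⁻ u : EuclideanSpace ℝ (Fin N), gaussWeight u with hW
  have hW0 : W ≠ 0 := lintegral_gaussWeight_pos
  have hWt : W ≠ ∞ := lintegral_gaussWeight_lt_top.ne
  by_contra hlt
  push Not at hlt
  set L := ∫⁻ u, gaussWeight u * φ u with hL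
  have hxy : y - x ≠ 0 := by
    intro h0
    rw [sub_eq_zero.1 h0] at hy
    exact hx hy
  set ε := ‖y - x‖ with hε
  have hε0 : 0 < ε := norm_pos_iff.2 hxy
  set e := ε⁻¹ • (y - x) with he_def
  have he : ‖e‖ = 1 := by
    rw [he_def, norm_smul, norm_inv, Real.norm_of_nonneg hε0.le, ← hε, inv_mul_cancel₀ hε0.ne']
  set p0 := MvPolynomial.eval (fun i => (x i : ℂ)) Q with hp0
  set p := lineRestriction Q x e
  have hcoeff0 : PowerSeries.constantCoeff (p : PowerSeries ℂ) = Units.mk0 p0 hx := by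
    rw [← PowerSeries.coeff_zero_eq_constantCoeff_apply, Polynomial.coeff_coe,
      coeff_zero_lineRestriction]
    rfl
  have hc := PowerSeries.mul_invOfUnit _ _ hcoeff0
  set c := PowerSeries.invOfUnit (p : PowerSeries ℂ) (Units.mk0 p0 hx)
  have hroot : p.IsRoot (ε : ℂ) := by
    rw [Polynomial.IsRoot, eval_lineRestriction, ← hy]
    congr 2
    ext i
    have : y i = x i + ε * e i := by
      simp [he_def]
      field_simp
      ring
    rw [this]
    push_cast
    rfl
  refine not_summable_inverse_of_isRoot hc hroot ?_
  set lam := (L / W).toReal with hlam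
  have hLt : L ≠ ∞ := (hlt.trans_le le_top).ne
  have hLW : L = ENNReal.ofReal lam * W := by
    rw [hlam, ENNReal.ofReal_toReal (ENNReal.div_ne_top hLt hW0), ENNReal.div_mul_cancel hW0 hWt]
  have hlam0 : 0 ≤ lam := ENNReal.toReal_nonneg
  set Λ := lam + (Real.log B + Real.log N / 2 + 4 / 5) with hΛ
  have hΛε : Λ < -Real.log ε := by
    rw [hLW] at hlt
    have h1 := lt_of_mul_lt_mul_right' hlt
    have := (ENNReal.ofReal_lt_ofReal_iff_of_nonneg hlam0).1 h1
    linarith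
  have hbound : ∀ m : ℕ, m ≠ 0 → ‖p0‖ * ‖PowerSeries.coeff m c‖ ≤
      (m + 1 : ℝ) ^ Q.totalDegree * Real.exp Λ ^ m := by
    intro m hm
    by_cases hcm : PowerSeries.coeff m c = 0
    · rw [hcm, norm_zero, mul_zero]; positivity
    have h1 := ofReal_log_coeff_mul_le_lintegral le_rfl hB hφm hx hφ he hc hm hcm
    rw [← hW, ← hL, hLW, ← add_mul,
      ← ENNReal.ofReal_add hlam0 (by norm_num),
      ENNReal.mul_le_mul_iff_left hW0 hWt] at h1
    have h2 := (ENNReal.ofReal_le_ofReal_iff (by positivity)).1 h1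
    have hm' : (0 : ℝ) < m := by positivity
    have h3 : Real.log (‖p0‖ * ‖PowerSeries.coeff m c‖ / (m + 1) ^ Q.totalDegree) ≤ m * Λ := by
      rw [← inv_mul_le_iff₀ hm', ← one_div]
      linarith
    have hpos : 0 < ‖p0‖ * ‖PowerSeries.coeff m c‖ / (m + 1 : ℝ) ^ Q.totalDegree := by
      have : p0 ≠ 0 := hx
      positivity
    rw [Real.log_le_iff_le_exp hpos, div_le_iff₀ (by positivity), Real.exp_nat_mul] at h3
    linarith
  refine summable_norm_mul_pow hx hε0 ?_ hbound
  rw [← Real.exp_log hε0, ← Real.exp_add, Real.exp_lt_one_iff]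
  linarith

end DirectionBound

section ZeroPotential

variable {N : ℕ}

/-- The pairs `(x, e)` such that `Q x ≠ 0` while `τ ↦ Q (x + τ e)` has a zero of modulus at
most `R`. -/
def nearZeroSet (Q : MvPolynomial (Fin N) ℂ) (R : ℝ) :
    Set (EuclideanSpace ℝ (Fin N) × EuclideanSpace ℝ (Fin N)) :=
  {z | MvPolynomial.eval (fun i => (z.1 i : ℂ)) Q ≠ 0 ∧ ∃ τ ∈ Metric.closedBall (0 : ℂ) R,
    MvPolynomial.eval (fun i => (z.1 i : ℂ) + τ * (z.2 i : ℂ)) Q = 0}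

theorem measurableSet_nearZeroSet (Q : MvPolynomial (Fin N) ℂ) (R : ℝ) :
    MeasurableSet (nearZeroSet Q R) := by
  have h1 : Continuous fun z : EuclideanSpace ℝ (Fin N) × EuclideanSpace ℝ (Fin N) =>
      MvPolynomial.eval (fun i => (z.1 i : ℂ)) Q :=
    (MvPolynomial.continuous_eval Q).comp (by fun_prop)
  have h2 : Continuous fun w : (EuclideanSpace ℝ (Fin N) × EuclideanSpace ℝ (Fin N)) ×
      Metric.closedBall (0 : ℂ) R =>
      MvPolynomial.eval (fun i => (w.1.1 i : ℂ) + (w.2 : ℂ) * (w.1.2 i : ℂ)) Q :=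
    (MvPolynomial.continuous_eval Q).comp (by fun_prop)
  have h3 := isClosedMap_fst_of_compactSpace _ (isClosed_singleton.preimage h2 : IsClosed
    ((fun w : (EuclideanSpace ℝ (Fin N) × EuclideanSpace ℝ (Fin N)) ×
      Metric.closedBall (0 : ℂ) R =>
      MvPolynomial.eval (fun i => (w.1.1 i : ℂ) + (w.2 : ℂ) * (w.1.2 i : ℂ)) Q) ⁻¹' {0}))
  have h4 := (isOpen_compl_singleton.preimage h1 : IsOpen
    ((fun z : EuclideanSpace ℝ (Fin N) × EuclideanSpace ℝ (Fin N) =>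
      MvPolynomial.eval (fun i => (z.1 i : ℂ)) Q) ⁻¹' {0}ᶜ))
  convert h4.measurableSet.inter h3.measurableSet using 1
  ext z
  simp [nearZeroSet]

/-- `max 0 (-log (B ‖τ‖))` for the zero `τ` of smallest modulus of `τ ↦ Q (x + τ e)`
(and `0` if `Q x = 0`). -/
noncomputable def zeroPotential (Q : MvPolynomial (Fin N) ℂ) (B : ℝ)
    (x e : EuclideanSpace ℝ (Fin N)) : ℝ≥0∞ :=
  ⨆ c : ℚ, (nearZeroSet Q (Real.exp (-(c : ℝ)) / B)).indicator
    (fun _ => ENNReal.ofReal c) (x, e)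

theorem measurable_zeroPotential (Q : MvPolynomial (Fin N) ℂ) (B : ℝ) :
    Measurable (Function.uncurry (zeroPotential Q B)) :=
  .iSup fun _ => measurable_const.indicator (measurableSet_nearZeroSet Q _)

theorem le_zeroPotential {Q : MvPolynomial (Fin N) ℂ} {B : ℝ} (hB : 0 < B)
    {x e : EuclideanSpace ℝ (Fin N)} (hx : MvPolynomial.eval (fun i => (x i : ℂ)) Q ≠ 0) {τ : ℂ}
    (hτ : MvPolynomial.eval (fun i => (x i : ℂ) + τ * (e i : ℂ)) Q = 0) :
    ENNReal.ofReal (-Real.log (B * ‖τ‖)) ≤ zeroPotential Q B x e := by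
  have hτ0 : 0 < ‖τ‖ := by
    rw [norm_pos_iff]
    rintro rfl
    apply hx
    simpa using hτ
  refine le_of_forall_lt fun b hb => ?_
  obtain ⟨q, hq1, hq2⟩ := exists_rat_btwn ((ENNReal.lt_ofReal_iff_toReal_lt hb.ne_top).1 hb)
  have hbq : b < ENNReal.ofReal q := (ENNReal.lt_ofReal_iff_toReal_lt hb.ne_top).2 hq1
  refine hbq.trans_le ?_
  refine le_trans ?_ (le_iSup _ q)
  rw [Set.indicator_of_mem]
  refine ⟨hx, τ, ?_, hτ⟩
  rw [mem_closedBall_zero_iff, le_div_iff₀ hB, mul_comm, ← Real.log_le_iff_le_exp (by positivity)]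
  linarith

theorem zeroPotential_le {Q : MvPolynomial (Fin N) ℂ} {B : ℝ} (hB : 0 < B)
    {x e : EuclideanSpace ℝ (Fin N)} {T : ℝ≥0∞}
    (hT : MvPolynomial.eval (fun i => (x i : ℂ)) Q ≠ 0 → ∀ τ : ℂ,
      MvPolynomial.eval (fun i => (x i : ℂ) + τ * (e i : ℂ)) Q = 0 →
        ENNReal.ofReal (-Real.log (B * ‖τ‖)) ≤ T) :
    zeroPotential Q B x e ≤ T := by
  refine iSup_le fun c => ?_
  by_cases hc : (x, e) ∈ nearZeroSet Q (Real.exp (-(c : ℝ)) / B)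
  · rw [Set.indicator_of_mem hc]
    obtain ⟨hx, τ, hτR, hτ⟩ := hc
    refine le_trans (ENNReal.ofReal_le_ofReal ?_) (hT hx τ hτ)
    have hτ0 : 0 < ‖τ‖ := by
      rw [norm_pos_iff]
      rintro rfl
      apply hx
      simpa using hτ
    rw [mem_closedBall_zero_iff, le_div_iff₀ hB, mul_comm,
      ← Real.log_le_iff_le_exp (by positivity)] at hτR
    linarith
  · rw [Set.indicator_of_notMem hc]
    exact zero_le

theorem exists_roots_zeroPotential_le {Q : MvPolynomial (Fin N) ℂ} {B : ℝ} (hB : 0 < B)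
    (x e : EuclideanSpace ℝ (Fin N)) :
    ∃ M : Multiset ℂ, M.card ≤ Q.totalDegree ∧ ∀ s : ℝ,
      zeroPotential Q B (x + s • e) e ≤ (M.map fun r => negLog (B * (s - r.re))).sum := by
  set p := lineRestriction Q x e with hp
  refine ⟨p.roots, p.card_roots'.trans (natDegree_lineRestriction_le Q x e), fun s => ?_⟩
  refine zeroPotential_le hB fun hx τ hτ => ?_
  have hp0 : p ≠ 0 := by
    intro h0
    apply hx
    have := eval_lineRestriction Q x e s
    rw [← hp, h0, Polynomial.eval_zero] at this
    rw [this]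
    simp
  have hroot : (s : ℂ) + τ ∈ p.roots := by
    rw [Polynomial.mem_roots hp0, Polynomial.IsRoot, eval_lineRestriction, ← hτ]
    congr 2
    ext i
    simp
    ring
  obtain ⟨M', hM'⟩ := Multiset.exists_cons_of_mem hroot
  rw [hM', Multiset.map_cons, Multiset.sum_cons]
  refine le_trans (le_negLog ?_) le_self_add
  rw [abs_mul, abs_of_pos hB]
  gcongr
  simpa using Complex.abs_re_le_norm τ

end ZeroPotential

section ConvexExpansion

variable {E : Type*} [NormedAddCommGroup E] [InnerProductSpace ℝ E] [FiniteDimensional ℝ E]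
  [MeasurableSpace E] [BorelSpace E]

omit [FiniteDimensional ℝ E] [MeasurableSpace E] [BorelSpace E] in
theorem homothety_mem_of_near {K : Set E} (hK : Convex ℝ K) {c : E} {ρ η : ℝ} (hρ : 0 < ρ)
    (hη : 0 < η) (hball : Metric.ball c ρ ⊆ K) {k w : E} (hk : k ∈ K) (hw : ‖w‖ < η) :
    AffineMap.homothety c (1 + η / ρ)⁻¹ (k + w) ∈ K := by
  have hmem : c + (ρ / η) • w ∈ K := hball (by
    rw [Metric.mem_ball, dist_self_add_left, norm_smul, Real.norm_of_nonneg (by positivity)]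
    calc ρ / η * ‖w‖ < ρ / η * η := by gcongr
      _ = ρ := by field_simp)
  have h1 : (0 : ℝ) < 1 + η / ρ := by positivity
  have := hK hk hmem (a := (1 + η / ρ)⁻¹) (b := (η / ρ) * (1 + η / ρ)⁻¹) (by positivity)
    (by positivity) (by field_simp)
  convert this using 1
  rw [AffineMap.homothety_apply, vsub_eq_sub, vadd_eq_add, smul_add, smul_smul,
    show η / ρ * (1 + η / ρ)⁻¹ * (ρ / η) = (1 + η / ρ)⁻¹ by field_simp,
    show η / ρ * (1 + η / ρ)⁻¹ = 1 - (1 + η / ρ)⁻¹ by field_simp; ring]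
  module

theorem volume_add_le_of_near {J J' : Set ℝ} (hJ : Convex ℝ J) (hne : J.Nonempty)
    (hb : Bornology.IsBounded J) {η : ℝ} (hη : 0 < η)
    (hJJ' : ∀ s ∈ J, ∀ t, |t| < η → s + t ∈ J') :
    volume J + ENNReal.ofReal (2 * η) ≤ volume J' := by
  have hba := hb.bddAbove
  have hbb := hb.bddBelow
  have h1 : volume J ≤ ENNReal.ofReal (sSup J - sInf J) := by
    rw [← Real.volume_Icc]
    exact measure_mono fun s hs => ⟨csInf_le hbb hs, le_csSup hba hs⟩
  have h0 : sInf J ≤ sSup J := csInf_le_csSup hne hbb hba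
  have h2 : Set.Ioo (sInf J - η) (sSup J + η) ⊆ J' := by
    intro t ht
    obtain ⟨j1, hj1, hj1t⟩ := exists_lt_of_csInf_lt hne (show sInf J < t + η by linarith [ht.1])
    obtain ⟨j2, hj2, hj2t⟩ := exists_lt_of_lt_csSup hne (show t - η < sSup J by linarith [ht.2])
    have hnear : ∀ j ∈ J, |t - j| < η → t ∈ J' := fun j hj h => by
      simpa using hJJ' j hj (t - j) h
    rcases le_or_gt t j1 with h | h
    · exact hnear j1 hj1 (by rw [abs_lt]; constructor <;> linarith)
    rcases le_or_gt j2 t with h' | h'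
    · exact hnear j2 hj2 (by rw [abs_lt]; constructor <;> linarith)
    · exact hnear t (hJ.ordConnected.out hj1 hj2 ⟨h.le, h'.le⟩) (by simpa using hη)
  calc _ ≤ ENNReal.ofReal (sSup J - sInf J) + ENNReal.ofReal (2 * η) := by gcongr
    _ = volume (Set.Ioo (sInf J - η) (sSup J + η)) := by
      rw [Real.volume_Ioo, ← ENNReal.ofReal_add (by linarith) (by linarith)]
      congr 1
      ring
    _ ≤ _ := measure_mono h2

theorem volume_eq_homothety_preimage (c : E) {lam : ℝ} (hlam : 0 < lam) (K : Set E) :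
    volume (AffineMap.homothety c lam⁻¹ ⁻¹' K) =
      ENNReal.ofReal (lam ^ Module.finrank ℝ E) * volume K := by
  have h : AffineMap.homothety c lam '' K = AffineMap.homothety c lam⁻¹ ⁻¹' K := by
    have h1 : ∀ x : E, AffineMap.homothety c lam⁻¹ (AffineMap.homothety c lam x) = x := fun x => by
      simp [AffineMap.homothety_apply, smul_smul, inv_mul_cancel₀ hlam.ne']
    have h2 : ∀ x : E, AffineMap.homothety c lam (AffineMap.homothety c lam⁻¹ x) = x := fun x => by
      simp [AffineMap.homothety_apply, smul_smul, mul_inv_cancel₀ hlam.ne']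
    exact congrFun (Set.image_eq_preimage_of_inverse h1 h2) K
  rw [← h, Measure.addHaar_image_homothety, abs_of_pos (by positivity)]

end ConvexExpansion

section NullZeroSet

variable {N : ℕ}

theorem MvPolynomial.IsHomogeneous.eval_smul_eq {R ι : Type*} [CommRing R]
    {P : MvPolynomial ι R} {k : ℕ} (hP : P.IsHomogeneous k) (t : R) (x : ι → R) :
    MvPolynomial.eval (fun i => t * x i) P = t ^ k * MvPolynomial.eval x P := by
  rw [MvPolynomial.eval_eq, MvPolynomial.eval_eq, Finset.mul_sum]
  refine Finset.sum_congr rfl fun m hm => ?_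
  have hk : ∑ i ∈ m.support, m i = k := by
    have := hP (MvPolynomial.mem_support_iff.1 hm)
    rwa [Finsupp.weight_apply, Finsupp.sum, Finset.sum_congr rfl fun i _ => by
      rw [Pi.one_apply, smul_eq_mul, mul_one]] at this
  simp_rw [mul_pow, Finset.prod_mul_distrib]
  rw [Finset.prod_pow_eq_pow_sum, hk]
  ring

theorem lineRestriction_ne_zero_of_isHomogeneous {Q : MvPolynomial (Fin N) ℂ} {k : ℕ}
    (hQ : Q.IsHomogeneous k) {u : EuclideanSpace ℝ (Fin N)}
    (hu : MvPolynomial.eval (fun i => (u i : ℂ)) Q ≠ 0) (x : EuclideanSpace ℝ (Fin N)) :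
    lineRestriction Q x u ≠ 0 := by
  intro h0
  have hswap : lineRestriction Q u x = 0 := by
    refine Polynomial.eq_zero_of_infinite_isRoot _ (Set.Infinite.mono (s := {0}ᶜ) ?_
      (Set.finite_singleton (0 : ℂ)).infinite_compl)
    intro t ht
    have ht' : t ≠ 0 := ht
    have h1 := eval_lineRestriction Q x u t⁻¹
    rw [h0, Polynomial.eval_zero] at h1
    have h2 := hQ.eval_smul_eq t fun i => (x i : ℂ) + t⁻¹ * (u i : ℂ)
    rw [← h1, mul_zero] at h2
    change Polynomial.eval t _ = 0
    rw [eval_lineRestriction, ← h2]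
    congr 2
    ext i
    field_simp
    ring
  apply hu
  rw [← coeff_zero_lineRestriction Q u x, hswap, Polynomial.coeff_zero]

theorem ae_eval_ne_zero {Q : MvPolynomial (Fin N) ℂ} {k : ℕ}
    (hQ : Q.IsHomogeneous k) {u : EuclideanSpace ℝ (Fin N)} (hu1 : ‖u‖ = 1)
    (hu : MvPolynomial.eval (fun i => (u i : ℂ)) Q ≠ 0) :
    ∀ᵐ x : EuclideanSpace ℝ (Fin N), MvPolynomial.eval (fun i => (x i : ℂ)) Q ≠ 0 := by
  have hc : Continuous fun x : EuclideanSpace ℝ (Fin N) =>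
      MvPolynomial.eval (fun i => (x i : ℂ)) Q :=
    (MvPolynomial.continuous_eval Q).comp (by fun_prop)
  set Z := (fun x : EuclideanSpace ℝ (Fin N) => MvPolynomial.eval (fun i => (x i : ℂ)) Q) ⁻¹' {0}
    with hZdef
  have hZ : MeasurableSet Z := (isClosed_singleton.preimage hc).measurableSet
  have h0 : ∫⁻ x, Z.indicator (fun _ => (1 : ℝ≥0∞)) x ≤
      ∫⁻ _ : EuclideanSpace ℝ (Fin N), 0 := by
    refine lintegral_le_of_forall_line_le hu1 (measurable_const.indicator hZ) measurable_const
      fun x => ?_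
    have hfin : {s : ℝ | x + s • u ∈ Z}.Finite := by
      have hp := lineRestriction_ne_zero_of_isHomogeneous hQ hu x
      have h1 := (Polynomial.finite_setOfPred_isRoot hp).preimage
        (f := fun s : ℝ => (s : ℂ)) (Complex.ofReal_injective.injOn)
      refine h1.subset fun s hs => ?_
      change Polynomial.eval (s : ℂ) _ = 0
      rw [eval_lineRestriction]
      have hs' : MvPolynomial.eval (fun i => ((x + s • u) i : ℂ)) Q = 0 := hs
      rw [← hs']
      simp
    have h2 : (fun t : ℝ => Z.indicator (fun _ => (1 : ℝ≥0∞)) (x + t • u)) =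
        {s : ℝ | x + s • u ∈ Z}.indicator fun _ => 1 := rfl
    rw [h2, lintegral_indicator_const hfin.measurableSet, hfin.measure_zero]
    simp
  rw [lintegral_indicator_const hZ, lintegral_zero, one_mul] at h0
  exact compl_mem_ae_iff.2 (nonpos_iff_eq_zero.1 h0)

end NullZeroSet

section ConvexBody

variable {N : ℕ}

theorem setLIntegral_zeroPotential_le [NeZero N] {Q : MvPolynomial (Fin N) ℂ} {d : ℕ}
    (hd0 : 0 < d) (hd : Q.totalDegree ≤ d) {K : Set (EuclideanSpace ℝ (Fin N))} (hKc : Convex ℝ K)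
    (hKo : IsOpen K) (hKb : Bornology.IsBounded K) {c : EuclideanSpace ℝ (Fin N)} {ρ : ℝ}
    (hρ : 0 < ρ) (hball : Metric.ball c ρ ⊆ K) {e : EuclideanSpace ℝ (Fin N)} (he : ‖e‖ = 1) :
    ∫⁻ x in K, zeroPotential Q (8 * N * d / (7 * ρ)) x e ≤ volume K := by
  have hN : (0 : ℝ) < N := by exact_mod_cast NeZero.pos N
  have hd' : (0 : ℝ) < d := by exact_mod_cast hd0
  set B := 8 * N * d / (7 * ρ) with hB_def
  have hB : 0 < B := by positivity
  set η := ρ / (8 * N) with hη_def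
  have hη : 0 < η := by positivity
  set lam := 1 + η / ρ with hlam_def
  have hlam : 0 < lam := by positivity
  set K' := AffineMap.homothety c lam⁻¹ ⁻¹' K with hK'
  have hK'o : IsOpen K' := hKo.preimage (AffineMap.homothety_continuous _ _)
  set κ := ENNReal.ofReal (d / (B * η)) with hκ
  have hφ : Measurable fun x => zeroPotential Q B x e :=
    (measurable_zeroPotential Q B).of_uncurry_right
  have hline : ∫⁻ x, (K.indicator (fun x => zeroPotential Q B x e) x + K.indicator (fun _ => κ) x)
      ≤ ∫⁻ x, K'.indicator (fun _ => κ) x := by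
    refine lintegral_le_of_forall_line_le he
      ((hφ.indicator hKo.measurableSet).add (measurable_const.indicator hKo.measurableSet))
      (measurable_const.indicator hK'o.measurableSet) fun x => ?_
    have hcont : Continuous fun t : ℝ => x + t • e := by fun_prop
    set J := (fun t : ℝ => x + t • e) ⁻¹' K with hJ
    set J' := (fun t : ℝ => x + t • e) ⁻¹' K' with hJ'
    have hJm : MeasurableSet J := (hKo.preimage hcont).measurableSet
    have hJ'm : MeasurableSet J' := (hK'o.preimage hcont).measurableSet
    have e1 : (fun t : ℝ => K.indicator (fun x => zeroPotential Q B x e) (x + t • e)) =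
      J.indicator fun t => zeroPotential Q B (x + t • e) e := rfl
    have e2 : (fun t : ℝ => K.indicator (fun _ => κ) (x + t • e)) = J.indicator fun _ => κ := rfl
    have e3 : (fun t : ℝ => K'.indicator (fun _ => κ) (x + t • e)) = J'.indicator fun _ => κ := rfl
    rw [lintegral_add_right _ (by rw [e2]; exact measurable_const.indicator hJm), e1, e2, e3,
      lintegral_indicator_const hJm, lintegral_indicator_const hJ'm, lintegral_indicator hJm]
    rcases J.eq_empty_or_nonempty with hemp | hne
    · simp [hemp]
    obtain ⟨M, hM, hle⟩ := exists_roots_zeroPotential_le hB x e (Q := Q)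
    have hJc : Convex ℝ J := by
      intro s hs t ht p q hp hq hpq
      have h1 : p • (x + s • e) + q • (x + t • e) ∈ K := hKc hs ht hp hq hpq
      have h2 : p • (x + s • e) + q • (x + t • e) = x + (p • s + q • t) • e := by
        rw [smul_add, smul_add, add_add_add_comm, ← add_smul p q x, hpq, one_smul, smul_smul,
          smul_smul, ← add_smul]
        rfl
      rw [h2] at h1
      exact h1
    have hJb : Bornology.IsBounded J := by
      have hiso : Isometry fun t : ℝ => x + t • e := Isometry.of_dist_eq fun s t => by
        rw [dist_add_left, dist_eq_norm, ← sub_smul, norm_smul, he, mul_one, dist_eq_norm]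
      exact hiso.antilipschitz.isBounded_preimage hKb
    have hvol := volume_add_le_of_near hJc hne hJb hη (J' := J') fun s hs t ht => by
      have h1 := homothety_mem_of_near hKc hρ hη hball hs (w := t • e)
        (by rw [norm_smul, he, mul_one]; exact ht)
      change AffineMap.homothety c lam⁻¹ (x + (s + t) • e) ∈ K
      rwa [add_smul, ← add_assoc]
    have hφJ : ∫⁻ t in J, zeroPotential Q B (x + t • e) e ≤ κ * ENNReal.ofReal (2 * η) := by
      refine (setLIntegral_le_lintegral _ _).trans ((lintegral_mono hle).trans ?_)
      rw [lintegral_sum_negLog hB, hκ, ← ENNReal.ofReal_mul (by positivity),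
        ← ENNReal.ofReal_natCast, ← ENNReal.ofReal_mul (by positivity)]
      refine ENNReal.ofReal_le_ofReal ?_
      have hMd : (M.card : ℝ) ≤ d := by exact_mod_cast hM.trans hd
      calc (M.card : ℝ) * (2 / B) ≤ d * (2 / B) := by gcongr
        _ = d / (B * η) * (2 * η) := by field_simp
    calc _ ≤ κ * ENNReal.ofReal (2 * η) + κ * volume J := by gcongr
      _ = κ * (volume J + ENNReal.ofReal (2 * η)) := by ring
      _ ≤ _ := by gcongr
  have hKt : volume K ≠ ∞ := hKb.measure_lt_top.ne
  rw [lintegral_add_right _ (measurable_const.indicator hKo.measurableSet),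
    lintegral_indicator_const hKo.measurableSet, lintegral_indicator_const hK'o.measurableSet,
    lintegral_indicator hKo.measurableSet, hK', volume_eq_homothety_preimage c hlam] at hline
  rw [finrank_euclideanSpace, Fintype.card_fin] at hline
  refine ENNReal.le_of_add_le_add_right (ENNReal.mul_ne_top ENNReal.ofReal_ne_top hKt)
    (hline.trans ?_)
  rw [← mul_assoc, ← ENNReal.ofReal_mul (by positivity)]
  nth_rw 2 [← one_mul (volume K)]
  rw [← add_mul, ← ENNReal.ofReal_one, ← ENNReal.ofReal_add (by norm_num) (by positivity)]
  gcongr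
  have h87 : lam ^ N ≤ 8 / 7 := by
    have h1 : lam ≤ Real.exp (1 / (8 * N)) := by
      rw [hlam_def, hη_def, add_comm]
      refine le_trans (le_of_eq ?_) (Real.add_one_le_exp _)
      field_simp
    calc lam ^ N ≤ Real.exp (1 / (8 * N)) ^ N := by gcongr
      _ = (Real.exp (-(1 / 8)))⁻¹ := by
        rw [← Real.exp_nat_mul, ← Real.exp_neg]
        congr 1
        field_simp
      _ ≤ (7 / 8 : ℝ)⁻¹ := by
        gcongr
        linarith [Real.add_one_le_exp (-(1 / 8 : ℝ))]
      _ = 8 / 7 := by norm_num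
  have hBη : d / (B * η) = 7 := by
    rw [hB_def, hη_def]
    field_simp
  rw [hBη]
  linarith

/-- The mean of `-log dist(·, S)` over a convex body, for `S` inside a real algebraic
hypersurface. -/
theorem setLIntegral_neg_log_infDist_le [NeZero N] {Q : MvPolynomial (Fin N) ℂ} {d k : ℕ}
    (hd0 : 0 < d) (hd : Q.totalDegree ≤ d) (hQ : Q.IsHomogeneous k)
    {w : EuclideanSpace ℝ (Fin N)} (hw1 : ‖w‖ = 1)
    (hw : MvPolynomial.eval (fun i => (w i : ℂ)) Q ≠ 0)
    {S : Set (EuclideanSpace ℝ (Fin N))} (hS : IsClosed S) (hSne : S.Nonempty)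
    (hSQ : ∀ y ∈ S, MvPolynomial.eval (fun i => (y i : ℂ)) Q = 0)
    {K : Set (EuclideanSpace ℝ (Fin N))} (hKc : Convex ℝ K)
    (hKo : IsOpen K) (hKb : Bornology.IsBounded K) {c : EuclideanSpace ℝ (Fin N)} {ρ : ℝ}
    (hρ : 0 < ρ) (hball : Metric.ball c ρ ⊆ K) :
    ∫⁻ x in K, ENNReal.ofReal (-Real.log (Metric.infDist x S)) ≤
      volume K * (1 + ENNReal.ofReal
        (Real.log (8 * N * d / (7 * ρ)) + Real.log N / 2 + 4 / 5)) := by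
  have hN : (0 : ℝ) < N := by exact_mod_cast NeZero.pos N
  have hd' : (0 : ℝ) < d := by exact_mod_cast hd0
  set B := 8 * N * d / (7 * ρ) with hB_def
  have hB : 0 < B := by positivity
  set Λ := Real.log B + Real.log N / 2 + 4 / 5 with hΛ
  set W := ∫⁻ u : EuclideanSpace ℝ (Fin N), gaussWeight u with hW
  have hW0 : W ≠ 0 := lintegral_gaussWeight_pos
  have hWt : W ≠ ∞ := lintegral_gaussWeight_lt_top.ne
  have hgw := measurable_gaussWeight (E := EuclideanSpace ℝ (Fin N))
  obtain ⟨φ, hφe⟩ : ∃ φ : EuclideanSpace ℝ (Fin N) → EuclideanSpace ℝ (Fin N) → ℝ≥0∞,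
      ∀ x u, φ x u = zeroPotential Q B x (‖u‖⁻¹ • u) := ⟨_, fun _ _ => rfl⟩
  have hφ : Measurable (Function.uncurry φ) := by
    have h1 : Function.uncurry φ = fun z => Function.uncurry (zeroPotential Q B)
        (z.1, ‖z.2‖⁻¹ • z.2) := funext fun z => hφe z.1 z.2
    rw [h1]
    exact Measurable.comp (g := Function.uncurry (zeroPotential Q B))
      (f := fun z : EuclideanSpace ℝ (Fin N) × EuclideanSpace ℝ (Fin N) =>
        (z.1, ‖z.2‖⁻¹ • z.2)) (measurable_zeroPotential Q B) (by fun_prop)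
  have hφx : ∀ x, Measurable (φ x) := fun x => hφ.of_uncurry_left
  have hφu : ∀ u, Measurable fun x => φ x u := fun u => hφ.of_uncurry_right
  have hgφ : Measurable (Function.uncurry fun x u => gaussWeight u * φ x u) :=
    (hgw.comp measurable_snd).mul hφ
  have hpt : ∀ x, MvPolynomial.eval (fun i => (x i : ℂ)) Q ≠ 0 →
      W * ENNReal.ofReal (-Real.log (Metric.infDist x S)) ≤
        (∫⁻ u, gaussWeight u * φ x u) + W * ENNReal.ofReal Λ := by
    intro x hx
    obtain ⟨y, hyS, hy⟩ := hS.exists_infDist_eq_dist hSne x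
    have h1 := ofReal_neg_log_dist_mul_le_lintegral hB (hφx x) hx (hSQ y hyS) fun u τ hτ => by
      rcases eq_or_ne u 0 with rfl | hu
      · simp
      have hu' : ‖u‖ ≠ 0 := norm_ne_zero_iff.2 hu
      have h2 := le_zeroPotential hB hx (e := ‖u‖⁻¹ • u) (τ := τ * ‖u‖) (by
        rw [← hτ]
        congr 2
        ext i
        have hu'' : (‖u‖ : ℂ) ≠ 0 := by exact_mod_cast hu'
        simp only [PiLp.smul_apply, smul_eq_mul, Complex.ofReal_mul, Complex.ofReal_inv]
        field_simp)
      rw [hφe]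
      simpa using h2
    rw [hy, dist_comm, dist_eq_norm]
    calc W * ENNReal.ofReal (-Real.log ‖y - x‖)
        = W * ENNReal.ofReal ((-Real.log ‖y - x‖ - Λ) + Λ) := by rw [sub_add_cancel]
      _ ≤ W * (ENNReal.ofReal (-Real.log ‖y - x‖ - Λ) + ENNReal.ofReal Λ) := by
        gcongr; exact ENNReal.ofReal_add_le
      _ ≤ _ := by
        rw [mul_add, mul_comm W]
        gcongr
  have hbound : ∀ u, ∫⁻ x in K, φ x u ≤ volume K := by
    intro u
    rcases eq_or_ne u 0 with rfl | hu
    · have h0 : ∀ x, φ x 0 = 0 := fun x => by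
        rw [hφe]
        refine nonpos_iff_eq_zero.1 (zeroPotential_le hB fun hx τ hτ => absurd ?_ hx)
        simpa using hτ
      simp [h0]
    · simp_rw [hφe]
      exact setLIntegral_zeroPotential_le hd0 hd hKc hKo hKb hρ hball
        (by rw [norm_smul, norm_inv, norm_norm, inv_mul_cancel₀ (norm_ne_zero_iff.2 hu)])
  have hmeas : Measurable fun x => ENNReal.ofReal (-Real.log (Metric.infDist x S)) :=
    ((Real.measurable_log.comp (Metric.continuous_infDist_pt S).measurable).neg).ennreal_ofReal
  have hWle : W * ∫⁻ x in K, ENNReal.ofReal (-Real.log (Metric.infDist x S)) ≤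
      W * (volume K * (1 + ENNReal.ofReal Λ)) := by
    rw [← lintegral_const_mul _ hmeas]
    calc _ ≤ ∫⁻ x in K, ((∫⁻ u, gaussWeight u * φ x u) + W * ENNReal.ofReal Λ) :=
          lintegral_mono_ae (ae_restrict_of_ae ((ae_eval_ne_zero hQ hw1 hw).mono hpt))
      _ = (∫⁻ u, ∫⁻ x in K, gaussWeight u * φ x u) + W * ENNReal.ofReal Λ * volume K := by
          rw [lintegral_add_right _ measurable_const, setLIntegral_const,
            lintegral_lintegral_swap hgφ.aemeasurable]
      _ ≤ (∫⁻ u, gaussWeight u * volume K) + W * ENNReal.ofReal Λ * volume K := by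
          gcongr with u
          rw [lintegral_const_mul _ (hφu u)]
          gcongr
          exact hbound u
      _ = _ := by
          rw [lintegral_mul_const _ hgw]
          ring
  rwa [ENNReal.mul_le_mul_iff_right hW0 hWt] at hWle

end ConvexBody

section UniformlyDistributed

variable {X : Type*} [PseudoMetricSpace X] [SecondCountableTopology X] [MeasurableSpace X]
  [BorelSpace X]

theorem lintegral_measure_inter_ball {μ ν : Measure X} [SFinite μ] [SFinite ν] {s : Set X}
    (hμs : μ sᶜ = 0) {r : ℝ} {n : ℝ≥0∞} (hν : ∀ x ∈ s, ν (Metric.ball x r) = n) {U : Set X}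
    (hU : IsOpen U) :
    ∫⁻ x, μ (U ∩ Metric.ball x r) ∂ν = n * μ U := by
  set T : Set (X × X) := {z | z.2 ∈ U ∧ dist z.2 z.1 < r} with hT
  have hTm : MeasurableSet T := by
    refine IsOpen.measurableSet ?_
    exact (hU.preimage continuous_snd).inter
      (isOpen_lt (continuous_snd.dist continuous_fst) continuous_const)
  have h1 := Measure.prod_apply (μ := ν) (ν := μ) hTm
  rw [Measure.prod_apply_symm hTm] at h1
  change _ = ∫⁻ x, μ (U ∩ Metric.ball x r) ∂ν at h1
  rw [← h1]
  have h2 : ∀ᵐ y ∂μ, ν ((fun x => (x, y)) ⁻¹' T) = U.indicator (fun _ => n) y := by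
    filter_upwards [compl_mem_ae_iff.2 hμs] with y hy
    have hy' : y ∈ s := by simpa using hy
    by_cases hyU : y ∈ U
    · rw [Set.indicator_of_mem hyU, ← hν y hy']
      congr 1
      ext x
      simp [T, hyU, dist_comm]
    · rw [Set.indicator_of_notMem hyU]
      convert measure_empty (μ := ν)
      ext x
      simp [T, hyU]
  rw [lintegral_congr_ae h2, lintegral_indicator_const hU.measurableSet]

theorem measure_le_of_ball_eq {μ ν : Measure X} [IsFiniteMeasure μ] [IsFiniteMeasure ν]
    {s : Set X} (hμs : μ sᶜ = 0) (hνs : ν sᶜ = 0) {m : ℝ → ℝ≥0∞}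
    (hμ : ∀ x ∈ s, ∀ r, 0 < r → μ (Metric.ball x r) = m r)
    (hν : ∀ x ∈ s, ∀ r, 0 < r → ν (Metric.ball x r) = m r)
    (hm0 : ∀ r, 0 < r → m r ≠ 0) (hmt : ∀ r, m r ≠ ∞) {U : Set X} (hU : IsOpen U) :
    ν U ≤ μ U := by
  set r : ℕ → ℝ := fun k => 1 / ((k : ℝ) + 1) with hr
  have hr0 : ∀ k, 0 < r k := fun k => by positivity
  set φ : ℕ → X → ℝ≥0∞ := fun k x => (m (r k))⁻¹ * μ (U ∩ Metric.ball x (r k)) with hφ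
  have hmeas : ∀ k, Measurable fun x => μ (U ∩ Metric.ball x (r k)) := fun k => by
    have hTm : MeasurableSet {z : X × X | z.2 ∈ U ∧ dist z.2 z.1 < r k} :=
      ((hU.preimage continuous_snd).inter
        (isOpen_lt (continuous_snd.dist continuous_fst) continuous_const)).measurableSet
    exact measurable_measure_prodMk_left hTm
  have hint : ∀ k, ∫⁻ x, φ k x ∂ν = μ U := fun k => by
    rw [lintegral_const_mul _ (hmeas k),
      lintegral_measure_inter_ball hμs (fun x hx => hν x hx _ (hr0 k)) hU, ← mul_assoc,
      ENNReal.inv_mul_cancel (hm0 _ (hr0 k)) (hmt _), one_mul]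
  have hle : ∀ᵐ x ∂ν, U.indicator (fun _ => (1 : ℝ≥0∞)) x ≤ liminf (fun k => φ k x) atTop := by
    filter_upwards [compl_mem_ae_iff.2 hνs] with x hx
    have hx' : x ∈ s := by simpa using hx
    by_cases hxU : x ∈ U
    · obtain ⟨ε, hε, hball⟩ := Metric.isOpen_iff.1 hU x hxU
      rw [Set.indicator_of_mem hxU]
      have hlim : Tendsto r atTop (nhds 0) := tendsto_one_div_add_atTop_nhds_zero_nat
      refine le_liminf_of_le (by isBoundedDefault) ?_
      filter_upwards [hlim.eventually_lt_const hε] with k hk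
      rw [hφ]
      dsimp only
      rw [Set.inter_eq_right.2 ((Metric.ball_subset_ball hk.le).trans hball),
        hμ x hx' _ (hr0 k), ENNReal.inv_mul_cancel (hm0 _ (hr0 k)) (hmt _)]
    · rw [Set.indicator_of_notMem hxU]
      exact zero_le
  calc ν U = ∫⁻ x, U.indicator (fun _ => (1 : ℝ≥0∞)) x ∂ν := by
        rw [lintegral_indicator_const hU.measurableSet, one_mul]
    _ ≤ ∫⁻ x, liminf (fun k => φ k x) atTop ∂ν := lintegral_mono_ae hle
    _ ≤ liminf (fun k => ∫⁻ x, φ k x ∂ν) atTop :=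
        lintegral_liminf_le fun k => (hmeas k).const_mul _
    _ = μ U := by simp [hint]

/-- Two finite measures carried by `s`, of equal mass and each giving all balls of a given radius
centered in `s` the same mass, coincide. -/
theorem measure_eq_of_uniform_ball {μ ν : Measure X} [IsFiniteMeasure μ] [IsFiniteMeasure ν]
    {s : Set X} (hμs : μ sᶜ = 0) (hνs : ν sᶜ = 0) {m n : ℝ → ℝ≥0∞}
    (hμ : ∀ x ∈ s, ∀ r, 0 < r → μ (Metric.ball x r) = m r)
    (hν : ∀ x ∈ s, ∀ r, 0 < r → ν (Metric.ball x r) = n r)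
    (huniv : μ Set.univ = ν Set.univ) : μ = ν := by
  rcases eq_or_ne (μ Set.univ) 0 with h0 | h0
  · rw [Measure.measure_univ_eq_zero.1 h0,
      Measure.measure_univ_eq_zero.1 (huniv.symm.trans h0)]
  have hs : s.Nonempty := by
    by_contra hs
    rw [Set.not_nonempty_iff_eq_empty.1 hs, Set.compl_empty] at hμs
    exact h0 hμs
  obtain ⟨x₀, hx₀⟩ := hs
  have hmt : ∀ r, 0 < r → m r ≠ ∞ := fun r hr => by
    rw [← hμ x₀ hx₀ r hr]
    exact measure_ne_top _ _
  have hmn : ∀ r, 0 < r → m r = n r := fun r hr => by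
    have h1 := lintegral_measure_inter_ball hμs (fun x hx => hν x hx r hr) isOpen_univ
    have h2 : ∫⁻ x, μ (Set.univ ∩ Metric.ball x r) ∂ν = m r * ν Set.univ := by
      rw [← lintegral_const]
      refine lintegral_congr_ae ?_
      filter_upwards [compl_mem_ae_iff.2 hνs] with x hx
      rw [Set.univ_inter, hμ x (by simpa using hx) r hr]
    rw [h2, ← huniv] at h1
    exact (ENNReal.mul_left_inj h0 (measure_ne_top _ _)).1 h1
  have hm0 : ∀ r, 0 < r → m r ≠ 0 := fun r hr hmr => by
    apply h0
    have h1 := lintegral_measure_inter_ball hμs (fun x hx => hν x hx r hr) isOpen_univ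
    obtain ⟨t, hts, htc, htu⟩ := TopologicalSpace.countable_cover_nhdsWithin
      (s := s) (f := fun x => Metric.ball x r)
      fun x _ => mem_nhdsWithin_of_mem_nhds (Metric.ball_mem_nhds x hr)
    have h2 : μ (⋃ x ∈ t, Metric.ball x r) = 0 :=
      (measure_biUnion_null_iff htc).2 fun x hx => by rw [hμ x (hts hx) r hr, hmr]
    refine le_antisymm ?_ zero_le
    calc μ Set.univ ≤ μ (s ∪ sᶜ) := by rw [Set.union_compl_self]
      _ ≤ μ s + μ sᶜ := measure_union_le _ _
      _ ≤ 0 := by rw [hμs, measure_mono_null htu h2, add_zero]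
  have hν' : ∀ x ∈ s, ∀ r, 0 < r → ν (Metric.ball x r) = (if 0 < r then m r else 0) :=
    fun x hx r hr => by rw [if_pos hr, hν x hx r hr, hmn r hr]
  have hμ' : ∀ x ∈ s, ∀ r, 0 < r → μ (Metric.ball x r) = (if 0 < r then m r else 0) :=
    fun x hx r hr => by rw [if_pos hr, hμ x hx r hr]
  have hm0' : ∀ r : ℝ, 0 < r → (if 0 < r then m r else 0) ≠ 0 :=
    fun r hr => by rw [if_pos hr]; exact hm0 r hr
  have hmt' : ∀ r : ℝ, (if 0 < r then m r else 0) ≠ ∞ := fun r => by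
    split_ifs with hr
    · exact hmt r hr
    · simp
  refine ext_of_generate_finite _ BorelSpace.measurable_eq
    isPiSystem_isOpen (fun U hU => le_antisymm ?_ ?_) huniv
  · exact measure_le_of_ball_eq hνs hμs hν' hμ' hm0' hmt' hU
  · exact measure_le_of_ball_eq hμs hνs hμ' hν' hm0' hmt' hU

end UniformlyDistributed

section SphereMeasure

variable {E : Type*} [NormedAddCommGroup E] [InnerProductSpace ℝ E] [FiniteDimensional ℝ E]
  [MeasurableSpace E] [BorelSpace E]

omit [FiniteDimensional ℝ E] [MeasurableSpace E] [BorelSpace E] in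
theorem exists_linearIsometryEquiv_apply_eq {x y : E} (h : ‖x‖ = ‖y‖) :
    ∃ T : E ≃ₗᵢ[ℝ] E, T x = y :=
  ⟨_, Submodule.reflection_sub h⟩

variable (E) in
/-- The distribution of the direction of a point of the unit ball. -/
noncomputable def directionMeasure : Measure E :=
  (volume.restrict (Metric.ball (0 : E) 1)).map fun x => ‖x‖⁻¹ • x

omit [FiniteDimensional ℝ E] in
theorem measurable_inv_norm_smul : Measurable fun x : E => ‖x‖⁻¹ • x := by fun_prop

instance : IsFiniteMeasure (directionMeasure E) := by
  have : IsFiniteMeasure (volume.restrict (Metric.ball (0 : E) 1)) :=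
    ⟨by simpa using Metric.isBounded_ball.measure_lt_top⟩
  unfold directionMeasure
  infer_instance

theorem directionMeasure_apply {s : Set E} (hs : MeasurableSet s) :
    directionMeasure E s = volume ((fun x : E => ‖x‖⁻¹ • x) ⁻¹' s ∩ Metric.ball 0 1) := by
  rw [directionMeasure, Measure.map_apply measurable_inv_norm_smul hs,
    Measure.restrict_apply (measurable_inv_norm_smul hs)]

theorem directionMeasure_compl_sphere [Nontrivial E] :
    directionMeasure E (Metric.sphere 0 1)ᶜ = 0 := by
  rw [directionMeasure_apply Metric.isClosed_sphere.measurableSet.compl]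
  refine measure_mono_null (t := {0}) (fun x hx => ?_) (measure_singleton 0)
  by_contra h0
  apply hx.1
  have : ‖x‖ ≠ 0 := norm_ne_zero_iff.2 h0
  simp [norm_smul, this]

theorem directionMeasure_univ_ne_zero : directionMeasure E Set.univ ≠ 0 := by
  rw [directionMeasure_apply MeasurableSet.univ, Set.preimage_univ, Set.univ_inter]
  exact (Metric.measure_ball_pos volume _ one_pos).ne'

theorem directionMeasure_ball_apply (T : E ≃ₗᵢ[ℝ] E) (x : E) (r : ℝ) :
    directionMeasure E (Metric.ball (T x) r) = directionMeasure E (Metric.ball x r) := by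
  rw [directionMeasure_apply measurableSet_ball, directionMeasure_apply measurableSet_ball,
    ← T.measurePreserving.measure_preimage
      ((measurable_inv_norm_smul measurableSet_ball).inter measurableSet_ball).nullMeasurableSet]
  congr 1
  ext y
  simp only [Set.mem_preimage, Set.mem_inter_iff, Metric.mem_ball, LinearIsometryEquiv.norm_map,
    ← map_smul, LinearIsometryEquiv.dist_map, dist_zero_right]

omit [FiniteDimensional ℝ E] in
theorem hausdorffMeasure_sphere_inter_ball_apply (T : E ≃ₗᵢ[ℝ] E) (x : E) (r d : ℝ) :
    μH[d] (Metric.sphere 0 1 ∩ Metric.ball (T x) r) =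
      μH[d] (Metric.sphere (0 : E) 1 ∩ Metric.ball x r) := by
  rw [← T.toIsometryEquiv.hausdorffMeasure_preimage]
  congr 1
  ext y
  simp

/-- Normalized Hausdorff measure on a relatively open part of the sphere, in terms of volume. -/
theorem normalized_hausdorffMeasure_eq [Nontrivial E] {d : ℝ} {U : Set E} (hU : IsOpen U)
    (h0 : μH[d] (Metric.sphere 0 1 ∩ U) ≠ 0) (ht : μH[d] (Metric.sphere 0 1 ∩ U) ≠ ∞) :
    (μH[d] (Metric.sphere (0 : E) 1 ∩ U))⁻¹ • (μH[d]).restrict (Metric.sphere (0 : E) 1 ∩ U) =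
      (directionMeasure E (Metric.sphere 0 1 ∩ U))⁻¹ •
        (directionMeasure E).restrict (Metric.sphere 0 1 ∩ U) := by
  set s := Metric.sphere (0 : E) 1 with hs
  have hsm : MeasurableSet s := Metric.isClosed_sphere.measurableSet
  set ω := directionMeasure E with hω
  obtain ⟨a, has, haU⟩ : (s ∩ U).Nonempty := nonempty_of_measure_ne_zero h0
  have hT : ∀ x ∈ s, ∃ T : E ≃ₗᵢ[ℝ] E, T a = x := fun x hx =>
    exists_linearIsometryEquiv_apply_eq (by simp_all [s])
  have hball : ∀ x ∈ s, ∀ r, μH[d] (s ∩ Metric.ball x r) = μH[d] (s ∩ Metric.ball a r) :=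
    fun x hx r => by
      obtain ⟨T, rfl⟩ := hT x hx
      exact hausdorffMeasure_sphere_inter_ball_apply T a r d
  have hsfin : μH[d] s < ∞ := by
    obtain ⟨ε, hε, hsub⟩ := Metric.isOpen_iff.1 hU a haU
    refine (isCompact_sphere (0 : E) 1).measure_lt_top_of_nhdsWithin fun x hx =>
      ⟨s ∩ Metric.ball x ε, Filter.inter_mem self_mem_nhdsWithin
        (mem_nhdsWithin_of_mem_nhds (Metric.ball_mem_nhds x hε)), ?_⟩
    rw [hball x hx]
    exact (measure_mono (Set.inter_subset_inter_right s hsub)).trans_lt ht.lt_top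
  set ν := (μH[d] : Measure E).restrict s with hν
  have hνuniv : ν Set.univ = μH[d] s := by rw [hν, Measure.restrict_apply_univ]
  have : IsFiniteMeasure ν := ⟨by rwa [hνuniv]⟩
  have hω0 : ω Set.univ ≠ 0 := directionMeasure_univ_ne_zero
  have hωt : ω Set.univ ≠ ∞ := measure_ne_top _ _
  set c := ν Set.univ / ω Set.univ with hc
  have hct : c ≠ ∞ := ENNReal.div_ne_top (measure_ne_top _ _) hω0
  have hc0 : c ≠ 0 := by
    refine (ENNReal.div_pos ?_ hωt).ne'
    rw [hνuniv]
    exact fun h => h0 (measure_mono_null Set.inter_subset_left h)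
  have : IsFiniteMeasure (c • ω) := ω.smul_finite hct
  have hmain : ν = c • ω := by
    refine measure_eq_of_uniform_ball (s := s) (m := fun r => μH[d] (s ∩ Metric.ball a r))
      (n := fun r => c * ω (Metric.ball a r)) ?_ ?_ ?_ ?_ ?_
    · rw [hν, Measure.restrict_apply hsm.compl, Set.compl_inter_self, measure_empty]
    · rw [Measure.smul_apply, hω, hs, directionMeasure_compl_sphere, smul_zero]
    · intro x hx r _
      rw [hν, Measure.restrict_apply measurableSet_ball, Set.inter_comm, hball x hx r]
    · intro x hx r _
      obtain ⟨T, rfl⟩ := hT x hx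
      rw [Measure.smul_apply, hω, directionMeasure_ball_apply, smul_eq_mul]
    · rw [Measure.smul_apply, smul_eq_mul, hc, ENNReal.div_mul_cancel hω0 hωt]
  have hres : (μH[d] : Measure E).restrict (s ∩ U) = c • ω.restrict (s ∩ U) := by
    rw [← Measure.restrict_smul, ← hmain, hν, Measure.restrict_restrict (hsm.inter hU.measurableSet),
      Set.inter_eq_left.2 Set.inter_subset_left]
  have hval : μH[d] (s ∩ U) = c * ω (s ∩ U) := by
    have := congrArg (fun m : Measure E => m Set.univ) hres
    simpa using this
  rw [hres, hval, smul_smul, ENNReal.mul_inv (.inl hc0) (.inl hct), mul_right_comm,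
    ENNReal.inv_mul_cancel hc0 hct, one_mul]

end SphereMeasure

section PolarCoordinates

variable {F : Type*} [NormedAddCommGroup F] [NormedSpace ℝ F] [FiniteDimensional ℝ F] [Nontrivial F]
  [MeasurableSpace F] [BorelSpace F]

theorem lintegral_fun_norm (μ : Measure F) [μ.IsAddHaarMeasure] {f : ℝ → ℝ≥0∞}
    (hf : Measurable f) :
    ∫⁻ x, f ‖x‖ ∂μ = μ.toSphere Set.univ *
      ∫⁻ t in Set.Ioi (0 : ℝ), ENNReal.ofReal (t ^ (Module.finrank ℝ F - 1)) * f t := by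
  have h1 : ∫⁻ x, f ‖x‖ ∂μ = ∫⁻ x : ({(0)}ᶜ : Set F), f (‖x.1‖) ∂(μ.comap (↑)) := by
    rw [lintegral_subtype_comap (measurableSet_singleton _).compl fun x => f (‖x‖),
      restrict_compl_singleton]
  have hm : Measurable fun p : Metric.sphere (0 : F) 1 × Set.Ioi (0 : ℝ) => f p.2 := by fun_prop
  have h2 := μ.measurePreserving_homeomorphUnitSphereProd.lintegral_comp hm
  simp only [homeomorphUnitSphereProd_apply_snd_coe] at h2
  rw [h1, h2, lintegral_prod _ hm.aemeasurable]
  dsimp only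
  rw [lintegral_const, mul_comm, Measure.volumeIoiPow,
    lintegral_withDensity_eq_lintegral_mul _ (by fun_prop) (by fun_prop)]
  congr 1
  exact lintegral_subtype_comap measurableSet_Ioi
    fun t : ℝ => ENNReal.ofReal (t ^ (Module.finrank ℝ F - 1)) * f t

theorem toSphere_univ_ne_zero (μ : Measure F) [μ.IsAddHaarMeasure] :
    μ.toSphere Set.univ ≠ 0 := by
  rw [Measure.toSphere_apply_univ]
  refine mul_ne_zero ?_ (Metric.measure_ball_pos μ _ one_pos).ne'
  exact_mod_cast Module.finrank_pos.ne'

theorem lintegral_sin_eq (G : ℝ → ℝ≥0∞) (m : ℕ) :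
    ∫⁻ r in Set.Ioo (0 : ℝ) 1, ENNReal.ofReal (r ^ m / √(1 - r ^ 2)) * G r =
      ∫⁻ θ in Set.Ioo 0 (Real.pi / 2), ENNReal.ofReal (Real.sin θ ^ m) * G (Real.sin θ) := by
  have himg : Real.sin '' Set.Ioo 0 (Real.pi / 2) = Set.Ioo 0 1 := by
    ext r
    constructor
    · rintro ⟨θ, ⟨h0, h1⟩, rfl⟩
      refine ⟨Real.sin_pos_of_pos_of_lt_pi h0 (by linarith [Real.pi_pos]), ?_⟩
      rw [← Real.sin_pi_div_two]
      exact Real.sin_lt_sin_of_lt_of_le_pi_div_two (by linarith) le_rfl h1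
    · rintro ⟨h0, h1⟩
      exact ⟨Real.arcsin r, ⟨Real.arcsin_pos.2 h0, Real.arcsin_lt_pi_div_two.2 h1⟩,
        Real.sin_arcsin (by linarith) h1.le⟩
  have hinj : Set.InjOn Real.sin (Set.Ioo 0 (Real.pi / 2)) :=
    Real.injOn_sin.mono (Set.Ioo_subset_Icc_self.trans (Set.Icc_subset_Icc_left
      (by linarith [Real.pi_pos])))
  rw [← himg, lintegral_image_eq_lintegral_abs_deriv_mul measurableSet_Ioo
    (fun θ _ => (Real.hasDerivAt_sin θ).hasDerivWithinAt) hinj]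
  refine setLIntegral_congr_fun measurableSet_Ioo fun θ hθ => ?_
  have hc : 0 < Real.cos θ := Real.cos_pos_of_mem_Ioo ⟨by linarith [hθ.1, Real.pi_pos], hθ.2⟩
  rw [← mul_assoc, ← ENNReal.ofReal_mul (abs_nonneg _), ← Real.cos_sq', Real.sqrt_sq hc.le,
    abs_of_pos hc, mul_div_cancel₀ _ hc.ne']

theorem lintegral_halfDisk_eq {G : ℝ → ℝ≥0∞} (hG : Measurable G) (m : ℕ) :
    ∫⁻ z in {z : ℝ × ℝ | (0 < z.1 ∧ 0 < z.2) ∧ z.1 ^ 2 + z.2 ^ 2 < 1},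
      ENNReal.ofReal (z.2 ^ m) * G (z.2 / √(z.1 ^ 2 + z.2 ^ 2)) =
    (∫⁻ R in Set.Ioo (0 : ℝ) 1, ENNReal.ofReal (R ^ (m + 1))) *
      ∫⁻ r in Set.Ioo (0 : ℝ) 1, ENNReal.ofReal (r ^ m / √(1 - r ^ 2)) * G r := by
  set D := {z : ℝ × ℝ | (0 < z.1 ∧ 0 < z.2) ∧ z.1 ^ 2 + z.2 ^ 2 < 1} with hD
  have hDm : MeasurableSet D := by
    refine IsOpen.measurableSet ?_
    exact ((isOpen_lt continuous_const continuous_fst).inter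
      (isOpen_lt continuous_const continuous_snd)).inter (isOpen_lt
        (f := fun z : ℝ × ℝ => z.1 ^ 2 + z.2 ^ 2) (by fun_prop) continuous_const)
  rw [← lintegral_indicator hDm, ← lintegral_comp_polarCoord_symm, lintegral_sin_eq,
    ← lintegral_prod_mul (by fun_prop) (by fun_prop), Measure.prod_restrict,
    ← lintegral_indicator polarCoord.open_target.measurableSet,
    ← lintegral_indicator (measurableSet_Ioo.prod measurableSet_Ioo), ← Measure.volume_eq_prod]
  congr 1
  ext ⟨R, θ⟩
  have hmem : (R, θ) ∈ polarCoord.target ∧ polarCoord.symm (R, θ) ∈ D ↔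
      (R, θ) ∈ Set.Ioo (0 : ℝ) 1 ×ˢ Set.Ioo 0 (Real.pi / 2) := by
    have hsq : (R * Real.cos θ) ^ 2 + (R * Real.sin θ) ^ 2 = R ^ 2 := by
      linear_combination R ^ 2 * Real.sin_sq_add_cos_sq θ
    simp only [polarCoord_target, polarCoord_symm_apply, D, Set.mem_prod, Set.mem_Ioi,
      Set.mem_Ioo, Set.mem_ofPred_eq, hsq]
    constructor
    · rintro ⟨⟨hR, h1, h2⟩, ⟨h3, h4⟩, h5⟩
      refine ⟨⟨hR, by nlinarith⟩, ?_, ?_⟩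
      · by_contra! h
        have := Real.sin_nonpos_of_nonpos_of_neg_pi_le h h1.le
        nlinarith
      · by_contra! h
        have := Real.cos_nonpos_of_pi_div_two_le_of_le h (by linarith)
        nlinarith
    · rintro ⟨⟨h1, h2⟩, h3, h4⟩
      refine ⟨⟨h1, by linarith [Real.pi_pos], by linarith⟩, ⟨mul_pos h1 ?_, mul_pos h1 ?_⟩, ?_⟩
      · exact Real.cos_pos_of_mem_Ioo ⟨by linarith, h4⟩
      · exact Real.sin_pos_of_pos_of_lt_pi h3 (by linarith)
      · nlinarith
  by_cases h : (R, θ) ∈ Set.Ioo (0 : ℝ) 1 ×ˢ Set.Ioo 0 (Real.pi / 2)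
  · rw [Set.indicator_of_mem h, Set.indicator_of_mem (hmem.2 h).1, Set.indicator_of_mem (hmem.2 h).2]
    have hR : 0 < R := h.1.1
    simp only [polarCoord_symm_apply, smul_eq_mul]
    rw [show (R * Real.cos θ) ^ 2 + (R * Real.sin θ) ^ 2 = R ^ 2 by
      linear_combination R ^ 2 * Real.sin_sq_add_cos_sq θ, Real.sqrt_sq hR.le,
      mul_div_cancel_left₀ _ hR.ne', ← mul_assoc, ← mul_assoc, ← ENNReal.ofReal_mul hR.le,
      ← ENNReal.ofReal_mul (by positivity)]
    congr 2
    ring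
  · rw [Set.indicator_of_notMem h]
    by_cases h1 : (R, θ) ∈ polarCoord.target
    · rw [Set.indicator_of_mem h1, Set.indicator_of_notMem fun h2 => h (hmem.1 ⟨h1, h2⟩), smul_zero]
    · rw [Set.indicator_of_notMem h1]

end PolarCoordinates

section ConeLaw

theorem lintegral_prod_fun_norm {F : Type*} [NormedAddCommGroup F] [NormedSpace ℝ F]
    [FiniteDimensional ℝ F] [Nontrivial F] [MeasurableSpace F] [BorelSpace F]
    (μ : Measure F) [μ.IsAddHaarMeasure] {f : ℝ × ℝ → ℝ≥0∞} (hf : Measurable f) :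
    ∫⁻ z, f (z.1, ‖z.2‖) ∂((volume : Measure ℝ).prod μ) = μ.toSphere Set.univ *
      ∫⁻ z in {z : ℝ × ℝ | 0 < z.2}, ENNReal.ofReal (z.2 ^ (Module.finrank ℝ F - 1)) * f z := by
  have hset : {z : ℝ × ℝ | 0 < z.2} = Set.univ ×ˢ Set.Ioi 0 := by ext; simp
  have hg : Measurable fun z : ℝ × ℝ =>
      ENNReal.ofReal (z.2 ^ (Module.finrank ℝ F - 1)) * f z := by fun_prop
  rw [lintegral_prod _ (by fun_prop), hset, Measure.volume_eq_prod, ← Measure.prod_restrict,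
    Measure.restrict_univ, lintegral_prod _ hg.aemeasurable, ← lintegral_const_mul _
      (Measurable.lintegral_prod_right (f := fun s t =>
        ENNReal.ofReal (t ^ (Module.finrank ℝ F - 1)) * f (s, t)) hg)]
  refine lintegral_congr fun s => ?_
  exact lintegral_fun_norm μ (f := fun t => f (s, t)) (by fun_prop)

theorem exists_measurePreserving_prod {n : ℕ} {a : EuclideanSpace ℝ (Fin (n + 1))}
    (ha : ‖a‖ = 1) :
    ∃ Ψ : EuclideanSpace ℝ (Fin (n + 1)) → ℝ × EuclideanSpace ℝ (Fin n),
      MeasurePreserving Ψ volume (volume.prod volume) ∧ (∀ x, ⟪x, a⟫ = (Ψ x).1) ∧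
        ∀ x, ‖x‖ ^ 2 = (Ψ x).1 ^ 2 + ‖(Ψ x).2‖ ^ 2 := by
  set V := WithLp 2 (ℝ × EuclideanSpace ℝ (Fin n)) with hV
  have hfin : Module.finrank ℝ (EuclideanSpace ℝ (Fin (n + 1))) = Module.finrank ℝ V := by
    rw [(WithLp.linearEquiv 2 ℝ (ℝ × EuclideanSpace ℝ (Fin n))).finrank_eq, Module.finrank_prod]
    simp [add_comm]
  set T₀ : EuclideanSpace ℝ (Fin (n + 1)) ≃ₗᵢ[ℝ] V := LinearIsometryEquiv.trans
    (stdOrthonormalBasis ℝ _).repr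
    (((stdOrthonormalBasis ℝ V).reindex (finCongr hfin.symm)).repr.symm) with hT₀
  set b : V := WithLp.toLp 2 ((1 : ℝ), 0) with hb
  have hb1 : ‖b‖ = 1 := by
    rw [hb, WithLp.prod_norm_eq_of_L2]
    simp
  obtain ⟨T₁, hT₁⟩ := exists_linearIsometryEquiv_apply_eq (x := T₀ a) (y := b)
    (by rw [T₀.norm_map, ha, hb1])
  set T := T₀.trans T₁ with hT
  have hTa : T a = b := hT₁
  refine ⟨fun x => WithLp.ofLp (T x), (WithLp.volume_preserving_ofLp _ _).comp T.measurePreserving,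
    fun x => ?_, fun x => ?_⟩
  · rw [← T.inner_map_map, hTa, hb, WithLp.prod_inner_apply]
    simp
  · rw [← T.norm_map, WithLp.prod_norm_sq_eq_of_L2, Real.norm_eq_abs, sq_abs]
    rfl

theorem exists_lintegral_cone_eq {n : ℕ} (hn : 1 ≤ n) {a : EuclideanSpace ℝ (Fin (n + 1))}
    (ha : ‖a‖ = 1) :
    ∃ C : ℝ≥0∞, C ≠ 0 ∧ C ≠ ∞ ∧ ∀ G : ℝ → ℝ≥0∞, Measurable G →
      ∫⁻ x in {x | ‖x‖ < 1 ∧ 0 < ⟪x, a⟫}, G (√(1 - ⟪‖x‖⁻¹ • x, a⟫ ^ 2)) =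
        C * ∫⁻ r in Set.Ioo (0 : ℝ) 1, ENNReal.ofReal (r ^ (n - 1) / √(1 - r ^ 2)) * G r := by
  have : Nonempty (Fin n) := ⟨⟨0, hn⟩⟩
  obtain ⟨Ψ, hΨ, hΨ1, hΨ2⟩ := exists_measurePreserving_prod ha
  set c := (volume : Measure (EuclideanSpace ℝ (Fin n))).toSphere Set.univ with hc
  set R := ∫⁻ R in Set.Ioo (0 : ℝ) 1, ENNReal.ofReal (R ^ (n - 1 + 1)) with hR
  have hR0 : R ≠ 0 := by
    rw [hR, Ne, setLIntegral_eq_zero_iff measurableSet_Ioo (by fun_prop)]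
    intro h
    have h1 : ∀ᵐ x : ℝ, x ∉ Set.Ioo (0 : ℝ) 1 := h.mono fun x h2 hx => by
      have := h2 hx
      rw [ENNReal.ofReal_eq_zero] at this
      exact absurd (pow_pos hx.1 _) (not_lt.2 this)
    have h2 := measure_eq_zero_iff_ae_notMem.2 h1
    simp at h2
  have hRt : R ≠ ∞ := by
    refine ne_top_of_le_ne_top (b := 1) (by simp) ?_
    calc R ≤ ∫⁻ R in Set.Ioo (0 : ℝ) 1, 1 := setLIntegral_mono (by fun_prop) fun x hx => by
          rw [ENNReal.ofReal_le_one]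
          exact pow_le_one₀ hx.1.le hx.2.le
      _ = 1 := by simp
  refine ⟨c * R, mul_ne_zero (toSphere_univ_ne_zero _) hR0,
    ENNReal.mul_ne_top (measure_ne_top _ _) hRt, fun G hG => ?_⟩
  set A := {z : ℝ × ℝ | 0 < z.1 ∧ z.1 ^ 2 + z.2 ^ 2 < 1} with hA
  have hAm : MeasurableSet A := by
    refine IsOpen.measurableSet ?_
    exact (isOpen_lt continuous_const continuous_fst).inter (isOpen_lt
      (f := fun z : ℝ × ℝ => z.1 ^ 2 + z.2 ^ 2) (by fun_prop) continuous_const)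
  set f : ℝ × ℝ → ℝ≥0∞ := A.indicator fun z => G (z.2 / √(z.1 ^ 2 + z.2 ^ 2)) with hf
  have hfm : Measurable f := (by fun_prop : Measurable fun z : ℝ × ℝ =>
    G (z.2 / √(z.1 ^ 2 + z.2 ^ 2))).indicator hAm
  have hDm : MeasurableSet {x : EuclideanSpace ℝ (Fin (n + 1)) | ‖x‖ < 1 ∧ 0 < ⟪x, a⟫} := by
    refine IsOpen.measurableSet ?_
    exact (isOpen_lt continuous_norm continuous_const).inter
      (isOpen_lt continuous_const (g := fun x => ⟪x, a⟫) (by fun_prop))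
  have hpt : ∀ x, {x | ‖x‖ < 1 ∧ 0 < ⟪x, a⟫}.indicator
      (fun x => G (√(1 - ⟪‖x‖⁻¹ • x, a⟫ ^ 2))) x = f ((Ψ x).1, ‖(Ψ x).2‖) := by
    intro x
    have hiff : x ∈ {x | ‖x‖ < 1 ∧ 0 < ⟪x, a⟫} ↔ ((Ψ x).1, ‖(Ψ x).2‖) ∈ A := by
      simp only [A, Set.mem_ofPred_eq, ← hΨ1]
      rw [and_comm, hΨ1, ← hΨ2, sq_lt_one_iff₀ (norm_nonneg _)]
    by_cases hx : x ∈ {x | ‖x‖ < 1 ∧ 0 < ⟪x, a⟫}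
    · rw [Set.indicator_of_mem hx, hf, Set.indicator_of_mem (hiff.1 hx)]
      have hx0 : 0 < ‖x‖ := by
        rw [norm_pos_iff]
        rintro rfl
        simpa using hx.2
      dsimp only
      rw [← hΨ2, Real.sqrt_sq hx0.le, real_inner_smul_left, hΨ1]
      congr 1
      rw [show 1 - (‖x‖⁻¹ * (Ψ x).1) ^ 2 = (‖(Ψ x).2‖ / ‖x‖) ^ 2 by
        field_simp
        linarith [hΨ2 x], Real.sqrt_sq (by positivity)]
    · rw [Set.indicator_of_notMem hx, hf, Set.indicator_of_notMem fun h => hx (hiff.2 h)]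
  rw [← lintegral_indicator hDm, lintegral_congr hpt,
    hΨ.lintegral_comp (f := fun z => f (z.1, ‖z.2‖)) (by fun_prop), lintegral_prod_fun_norm _ hfm,
    mul_assoc, ← lintegral_halfDisk_eq hG]
  have hmul : ∀ z, ENNReal.ofReal (z.2 ^ (n - 1)) * f z =
      A.indicator (fun z => ENNReal.ofReal (z.2 ^ (n - 1)) * G (z.2 / √(z.1 ^ 2 + z.2 ^ 2))) z :=
    fun z => by rw [hf, Set.indicator_mul_right]
  simp_rw [finrank_euclideanSpace, Fintype.card_fin, hmul]
  rw [setLIntegral_indicator hAm]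
  congr 3
  ext z
  simp only [A, Set.mem_inter_iff, Set.mem_ofPred_eq]
  tauto

end ConeLaw

section LayerCake

/-- Comparing two measures on initial intervals compares their integrals of antitone functions. -/
theorem setLIntegral_le_of_antitoneOn {A B : Measure ℝ} {σ : ℝ}
    (hAB : ∀ ρ ∈ Set.Ioc 0 σ, A (Set.Ioo 0 ρ) ≤ B (Set.Ioo 0 ρ)) (hA : ∀ ρ, A {ρ} = 0)
    {g : ℝ → ℝ} (hg : AntitoneOn g (Set.Ioc 0 σ)) (hg0 : ∀ r ∈ Set.Ioo 0 σ, 0 ≤ g r) :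
    ∫⁻ r in Set.Ioo 0 σ, ENNReal.ofReal (g r) ∂A ≤ ∫⁻ r in Set.Ioo 0 σ, ENNReal.ofReal (g r) ∂B := by
  have hmeas : ∀ μ : Measure ℝ, AEMeasurable g (μ.restrict (Set.Ioo 0 σ)) := fun μ =>
    aemeasurable_restrict_of_antitoneOn measurableSet_Ioo (hg.mono Set.Ioo_subset_Ioc_self)
  have hnn : ∀ μ : Measure ℝ, 0 ≤ᵐ[μ.restrict (Set.Ioo 0 σ)] g := fun μ =>
    (ae_restrict_mem measurableSet_Ioo).mono hg0
  rw [lintegral_eq_lintegral_meas_lt _ (hnn A) (hmeas A),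
    lintegral_eq_lintegral_meas_lt _ (hnn B) (hmeas B)]
  refine lintegral_mono fun t => ?_
  rw [Measure.restrict_apply' measurableSet_Ioo, Measure.restrict_apply' measurableSet_Ioo]
  set L := {r | t < g r} ∩ Set.Ioo 0 σ with hL
  rcases L.eq_empty_or_nonempty with h | ⟨r₀, hr₀⟩
  · simp [h]
  have hbdd : BddAbove L := ⟨σ, fun r hr => hr.2.2.le⟩
  set ρ := sSup L with hρ
  have hρ0 : 0 < ρ := hr₀.2.1.trans_le (le_csSup hbdd hr₀)
  have hρσ : ρ ≤ σ := csSup_le ⟨r₀, hr₀⟩ fun r hr => hr.2.2.le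
  have h1 : L ⊆ Set.Ioo 0 ρ ∪ {ρ} := fun r hr => by
    rcases (le_csSup hbdd hr).lt_or_eq with h | h
    · exact .inl ⟨hr.2.1, h⟩
    · exact .inr h
  have h2 : Set.Ioo 0 ρ ⊆ L := fun r hr => by
    obtain ⟨s, hs, hrs⟩ := exists_lt_of_lt_csSup ⟨r₀, hr₀⟩ hr.2
    refine ⟨?_, hr.1, hrs.trans hs.2.2⟩
    exact lt_of_lt_of_le hs.1
      (hg ⟨hr.1, (hrs.trans hs.2.2).le⟩ ⟨hs.2.1, hs.2.2.le⟩ hrs.le)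
  calc A L ≤ A (Set.Ioo 0 ρ) + A {ρ} := (measure_mono h1).trans (measure_union_le _ _)
    _ = A (Set.Ioo 0 ρ) := by rw [hA, add_zero]
    _ ≤ B (Set.Ioo 0 ρ) := hAB ρ ⟨hρ0, hρσ⟩
    _ ≤ B L := measure_mono h2

end LayerCake

section OneDimensional

theorem intervalIntegrable_rpow_div_sqrt {m σ : ℝ} (hm : 0 < m) (hσ0 : 0 ≤ σ) (hσ1 : σ ≤ 1) :
    IntervalIntegrable (fun r : ℝ => r ^ (m - 1) / √(1 - r ^ 2)) volume 0 σ := by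
  have h1 : IntervalIntegrable (fun r : ℝ => r ^ (m - 1) / √(1 - r ^ 2)) volume 0 1 := by
    have hb := (Complex.betaIntegral_convergent (u := m) (v := (1 / 2 : ℝ)) (by simpa using hm)
      (by rw [Complex.ofReal_re]; norm_num)).norm
    rw [intervalIntegrable_iff_integrableOn_Ioo_of_le zero_le_one] at hb ⊢
    refine Integrable.mono' hb (Measurable.aestronglyMeasurable (by fun_prop)) ?_
    filter_upwards [ae_restrict_mem measurableSet_Ioo] with r hr
    have hr1 : 0 < 1 - r := by linarith [hr.2]
    have hr2 : ((1 : ℂ) - r) = ((1 - r : ℝ) : ℂ) := by push_cast; rfl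
    rw [norm_mul, hr2, Complex.norm_cpow_eq_rpow_re_of_pos hr.1,
      Complex.norm_cpow_eq_rpow_re_of_pos hr1, Complex.sub_re, Complex.sub_re, Complex.ofReal_re,
      Complex.ofReal_re, Complex.one_re, show (1 / 2 - 1 : ℝ) = -(1 / 2) by norm_num,
      Real.rpow_neg hr1.le, ← Real.sqrt_eq_rpow, ← div_eq_mul_inv,
      Real.norm_of_nonneg (div_nonneg (Real.rpow_nonneg hr.1.le _) (Real.sqrt_nonneg _))]
    have : 0 < √(1 - r) := Real.sqrt_pos.2 hr1
    have := Real.rpow_nonneg hr.1.le (m - 1)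
    gcongr
    nlinarith [hr.1, hr.2]
  exact h1.mono_set (by
    rw [Set.uIcc_of_le hσ0, Set.uIcc_of_le zero_le_one]
    exact Set.Icc_subset_Icc_right hσ1)

theorem Ifun_pos {m σ : ℝ} (hm : 0 < m) (hσ0 : 0 < σ) (hσ1 : σ ≤ 1) : 0 < Ifun m σ := by
  refine intervalIntegral.intervalIntegral_pos_of_pos_on
    (intervalIntegrable_rpow_div_sqrt hm hσ0.le hσ1) (fun r hr => ?_) hσ0
  exact div_pos (Real.rpow_pos_of_pos hr.1 _) (Real.sqrt_pos.2 (by nlinarith [hr.1, hr.2]))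

theorem rpow_mul_Ifun_half_le {m σ : ℝ} (hm : 0 < m) (hσ0 : 0 < σ) (hσ1 : σ ≤ 1) :
    σ ^ (m / 2) * Ifun (m / 2) σ ≤ 2 * Ifun m σ := by
  set ρ := σ * 2 ^ (-(2 / m)) with hρ
  have h2 : (2 : ℝ) ^ (-(2 / m)) < 1 := Real.rpow_lt_one_of_one_lt_of_neg one_lt_two
    (neg_neg_of_pos (by positivity))
  have hρ0 : 0 < ρ := by positivity
  have hρ1 : ρ < 1 := (mul_lt_of_lt_one_right hσ0 h2).trans_le hσ1
  have hρm : 2 * ρ ^ (m / 2) = σ ^ (m / 2) := by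
    rw [hρ, Real.mul_rpow hσ0.le (by positivity), ← Real.rpow_mul zero_le_two,
      show -(2 / m) * (m / 2) = -1 by field_simp, Real.rpow_neg_one]
    ring
  set κ := (√(1 - ρ ^ 2))⁻¹ with hκ
  have hi1 := intervalIntegrable_rpow_div_sqrt hm hσ0.le hσ1
  have hi2 := intervalIntegrable_rpow_div_sqrt (half_pos hm) hσ0.le hσ1
  have hj1 : IntervalIntegrable (fun r : ℝ => r ^ (m - 1)) volume 0 σ :=
    intervalIntegral.intervalIntegrable_rpow' (by linarith)
  have hj2 : IntervalIntegrable (fun r : ℝ => r ^ (m / 2 - 1)) volume 0 σ :=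
    intervalIntegral.intervalIntegrable_rpow' (by linarith)
  have hzero : ∫ r in (0 : ℝ)..σ, κ * (2 * r ^ (m - 1) - σ ^ (m / 2) * r ^ (m / 2 - 1)) = 0 := by
    rw [intervalIntegral.integral_const_mul, intervalIntegral.integral_sub (hj1.const_mul _)
      (hj2.const_mul _), intervalIntegral.integral_const_mul, intervalIntegral.integral_const_mul,
      integral_rpow (.inl (by linarith)), integral_rpow (.inl (by linarith)), sub_add_cancel,
      sub_add_cancel, Real.zero_rpow hm.ne', Real.zero_rpow (half_pos hm).ne', sub_zero, sub_zero]
    have : σ ^ m = σ ^ (m / 2) * σ ^ (m / 2) := by rw [← Real.rpow_add hσ0, add_halves]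
    rw [this]
    field_simp
    ring
  have hle : ∫ r in (0 : ℝ)..σ, κ * (2 * r ^ (m - 1) - σ ^ (m / 2) * r ^ (m / 2 - 1)) ≤
      ∫ r in (0 : ℝ)..σ, (2 * (r ^ (m - 1) / √(1 - r ^ 2)) -
        σ ^ (m / 2) * (r ^ (m / 2 - 1) / √(1 - r ^ 2))) := by
    refine intervalIntegral.integral_mono_on_of_le_Ioo hσ0.le
      (((hj1.const_mul _).sub (hj2.const_mul _)).const_mul _)
      ((hi1.const_mul _).sub (hi2.const_mul _)) fun r hr => ?_
    have hr1 : 0 < 1 - r ^ 2 := by nlinarith [hr.1, hr.2]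
    have hρ2 : 0 < 1 - ρ ^ 2 := by nlinarith
    have hfac : 2 * r ^ (m - 1) - σ ^ (m / 2) * r ^ (m / 2 - 1) =
        2 * r ^ (m / 2 - 1) * (r ^ (m / 2) - ρ ^ (m / 2)) := by
      rw [← hρm, show m - 1 = m / 2 - 1 + m / 2 by ring, Real.rpow_add hr.1]
      ring
    have hrhs : 2 * (r ^ (m - 1) / √(1 - r ^ 2)) - σ ^ (m / 2) * (r ^ (m / 2 - 1) / √(1 - r ^ 2)) =
        (√(1 - r ^ 2))⁻¹ * (2 * r ^ (m - 1) - σ ^ (m / 2) * r ^ (m / 2 - 1)) := by ring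
    rw [hrhs, hfac]
    have hrp : 0 < r ^ (m / 2 - 1) := Real.rpow_pos_of_pos hr.1 _
    rcases le_total r ρ with h | h
    · refine mul_le_mul_of_nonpos_right ?_ (mul_nonpos_of_nonneg_of_nonpos (by positivity) ?_)
      · rw [hκ]
        have := Real.sqrt_pos.2 hρ2
        gcongr
        exact hr.1.le
      · linarith [Real.rpow_le_rpow hr.1.le h (half_pos hm).le]
    · refine mul_le_mul_of_nonneg_right ?_ (mul_nonneg (by positivity) ?_)
      · rw [hκ]
        have := Real.sqrt_pos.2 hr1
        gcongr
      · linarith [Real.rpow_le_rpow hρ0.le h (half_pos hm).le]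
  rw [hzero, intervalIntegral.integral_sub (hi1.const_mul _) (hi2.const_mul _),
    intervalIntegral.integral_const_mul, intervalIntegral.integral_const_mul] at hle
  change 0 ≤ 2 * Ifun m σ - σ ^ (m / 2) * Ifun (m / 2) σ at hle
  linarith

theorem intervalIntegrable_of_integral_eq_Ifun {m σ : ℝ} (hm : 0 < m) (hσ0 : 0 < σ) (hσ1 : σ ≤ 1)
    {f : ℝ → ℝ} (hint : ∫ r in (0 : ℝ)..σ, f r = Ifun m σ) : IntervalIntegrable f volume 0 σ := by
  by_contra h
  rw [intervalIntegral.integral_undef h] at hint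
  exact (Ifun_pos hm hσ0 hσ1).ne hint

theorem one_le_of_integral_eq_Ifun {m σ H : ℝ} (hm : 0 < m) (hσ0 : 0 < σ) (hσ1 : σ ≤ 1)
    {h : ℝ → ℝ} (hH : ∀ r ∈ Set.Ioo 0 σ, h r ≤ H)
    (hint : ∫ r in (0 : ℝ)..σ, h r * (r ^ (m - 1) / √(1 - r ^ 2)) = Ifun m σ) : 1 ≤ H := by
  have hI := Ifun_pos hm hσ0 hσ1
  have h1 := intervalIntegrable_rpow_div_sqrt hm hσ0.le hσ1
  have h2 : Ifun m σ ≤ H * Ifun m σ := by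
    nth_rw 1 [← hint]
    rw [Ifun, ← intervalIntegral.integral_const_mul]
    refine intervalIntegral.integral_mono_on_of_le_Ioo hσ0.le
      (intervalIntegrable_of_integral_eq_Ifun hm hσ0 hσ1 hint) (h1.const_mul _) fun r hr => ?_
    exact mul_le_mul_of_nonneg_right (hH r hr)
      (div_nonneg (Real.rpow_nonneg hr.1.le _) (Real.sqrt_nonneg _))
  by_contra! h3
  nlinarith

theorem setLIntegral_log_le {m σ H A : ℝ} (hm : 0 < m) (hσ0 : 0 < σ) (hσ1 : σ ≤ 1) (hA : 0 ≤ A)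
    {h : ℝ → ℝ} (h0 : ∀ r ∈ Set.Ioo 0 σ, 0 ≤ h r) (hH : ∀ r ∈ Set.Ioo 0 σ, h r ≤ H)
    (hint : ∫ r in (0 : ℝ)..σ, h r * (r ^ (m - 1) / √(1 - r ^ 2)) = Ifun m σ) :
    ∫⁻ r in Set.Ioo 0 σ, ENNReal.ofReal (h r * (r ^ (m - 1) / √(1 - r ^ 2))) *
        ENNReal.ofReal (A + Real.log (1 / r)) ≤
      ENNReal.ofReal (Ifun m σ) *
        ENNReal.ofReal (A + Real.log (1 / σ) + 2 / m * Real.log (2 * H)) := by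
  have hI := Ifun_pos hm hσ0 hσ1
  have hH1 := one_le_of_integral_eq_Ifun hm hσ0 hσ1 hH hint
  set K := A + Real.log (1 / σ) + 2 / m * (Real.log (2 * H) - 1) with hK
  set f : ℝ → ℝ := fun r => K * (h r * (r ^ (m - 1) / √(1 - r ^ 2))) +
    σ ^ (m / 2) / m * (r ^ (m / 2 - 1) / √(1 - r ^ 2)) with hf
  have hi1 := intervalIntegrable_of_integral_eq_Ifun hm hσ0 hσ1 hint
  have hi2 := intervalIntegrable_rpow_div_sqrt (half_pos hm) hσ0.le hσ1
  have hfi : IntervalIntegrable f volume 0 σ := (hi1.const_mul _).add (hi2.const_mul _)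
  have hpt : ∀ r ∈ Set.Ioo 0 σ, 0 ≤ (h r * (r ^ (m - 1) / √(1 - r ^ 2))) * (A + Real.log (1 / r)) ∧
      (h r * (r ^ (m - 1) / √(1 - r ^ 2))) * (A + Real.log (1 / r)) ≤ f r := by
    intro r hr
    have hr0 := hr.1
    have hw : 0 ≤ r ^ (m - 1) / √(1 - r ^ 2) :=
      div_nonneg (Real.rpow_nonneg hr0.le _) (Real.sqrt_nonneg _)
    have hlog : 0 ≤ Real.log (1 / r) :=
      Real.log_nonneg (by rw [le_div_iff₀ hr0]; linarith [hr.2])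
    refine ⟨mul_nonneg (mul_nonneg (h0 r hr) hw) (by linarith), ?_⟩
    set s := (σ / r) ^ (m / 2) with hs
    have hs0 : 0 < s := by positivity
    have hs1 : Real.log s = m / 2 * Real.log (σ / r) := Real.log_rpow (by positivity) _
    have hs2 : Real.log (s / (2 * H)) ≤ s / (2 * H) - 1 :=
      Real.log_le_sub_one_of_pos (by positivity)
    rw [Real.log_div hs0.ne' (by positivity), hs1] at hs2
    have hs3 : Real.log (1 / r) = Real.log (1 / σ) + Real.log (σ / r) := by
      rw [← Real.log_mul (by positivity) (by positivity)]
      congr 1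
      field_simp
    have hs4 : A + Real.log (1 / r) ≤ K + s / (m * H) := by
      have : Real.log (σ / r) ≤ 2 / m * (Real.log (2 * H) - 1 + s / (2 * H)) := by
        rw [div_mul_eq_mul_div, le_div_iff₀ hm]
        linarith
      rw [hs3, hK]
      have e : 2 / m * (Real.log (2 * H) - 1 + s / (2 * H)) =
        2 / m * (Real.log (2 * H) - 1) + s / (m * H) := by field_simp
      linarith
    have hsw : s * (r ^ (m - 1) / √(1 - r ^ 2)) =
        σ ^ (m / 2) * (r ^ (m / 2 - 1) / √(1 - r ^ 2)) := by
      rw [hs, Real.div_rpow hσ0.le hr0.le, show m - 1 = m / 2 - 1 + m / 2 by ring,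
        Real.rpow_add hr0]
      have := Real.rpow_pos_of_pos hr0 (m / 2)
      field_simp
    have hHm : h r / H ≤ 1 := (div_le_one (by linarith)).2 (hH r hr)
    calc _ ≤ (h r * (r ^ (m - 1) / √(1 - r ^ 2))) * (K + s / (m * H)) :=
          mul_le_mul_of_nonneg_left hs4 (mul_nonneg (h0 r hr) hw)
      _ = K * (h r * (r ^ (m - 1) / √(1 - r ^ 2))) +
          h r / H * ((s * (r ^ (m - 1) / √(1 - r ^ 2))) / m) := by
          have : H ≠ 0 := by linarith
          field_simp
      _ ≤ K * (h r * (r ^ (m - 1) / √(1 - r ^ 2))) +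
          1 * ((s * (r ^ (m - 1) / √(1 - r ^ 2))) / m) := by gcongr
      _ = f r := by
          rw [hsw, hf]
          ring
  have hIoo : IntegrableOn f (Set.Ioo 0 σ) :=
    (intervalIntegrable_iff_integrableOn_Ioo_of_le hσ0.le).1 hfi
  calc _ = ∫⁻ r in Set.Ioo 0 σ,
        ENNReal.ofReal ((h r * (r ^ (m - 1) / √(1 - r ^ 2))) * (A + Real.log (1 / r))) := by
        refine setLIntegral_congr_fun measurableSet_Ioo fun r hr => ?_
        refine (ENNReal.ofReal_mul (mul_nonneg (h0 r hr) ?_)).symm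
        exact div_nonneg (Real.rpow_nonneg hr.1.le _) (Real.sqrt_nonneg _)
    _ ≤ ∫⁻ r in Set.Ioo 0 σ, ENNReal.ofReal (f r) :=
        setLIntegral_mono' measurableSet_Ioo fun r hr => ENNReal.ofReal_le_ofReal (hpt r hr).2
    _ = ENNReal.ofReal (∫ r in Set.Ioo 0 σ, f r) := by
        refine (ofReal_integral_eq_lintegral_ofReal hIoo ?_).symm
        filter_upwards [ae_restrict_mem measurableSet_Ioo] with r hr
        exact (hpt r hr).1.trans (hpt r hr).2
    _ ≤ _ := by
        rw [← ENNReal.ofReal_mul hI.le, ← integral_Ioc_eq_integral_Ioo,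
          ← intervalIntegral.integral_of_le hσ0.le]
        refine ENNReal.ofReal_le_ofReal ?_
        rw [hf, intervalIntegral.integral_add (hi1.const_mul _) (hi2.const_mul _),
          intervalIntegral.integral_const_mul, intervalIntegral.integral_const_mul, hint]
        have h1 := rpow_mul_Ifun_half_le hm hσ0 hσ1
        have h2 : σ ^ (m / 2) / m * Ifun (m / 2) σ ≤ 2 * Ifun m σ / m := by
          rw [div_mul_eq_mul_div]
          gcongr
        have h3 : Ifun m σ * (A + Real.log (1 / σ) + 2 / m * Real.log (2 * H)) =
          K * Ifun m σ + 2 * Ifun m σ / m := by rw [hK]; ring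
        rw [h3]
        gcongr
        exact h2

end OneDimensional

section ConeOverCap

variable {E : Type*} [NormedAddCommGroup E] [InnerProductSpace ℝ E]

/-- The part in the open unit ball of the open convex cone over a spherical cap around `a`. -/
def capCone (a : E) (ρ : ℝ) : Set E :=
  {x | ‖x‖ < 1 ∧ √(1 - ρ ^ 2) * ‖x‖ < ⟪x, a⟫}

/-- The sine of the angle between `x` and the unit vector `a`. -/
noncomputable def sinAngle (a x : E) : ℝ :=
  √(1 - ⟪‖x‖⁻¹ • x, a⟫ ^ 2)

theorem ne_zero_of_mem_capCone {a x : E} {ρ : ℝ} (hx : x ∈ capCone a ρ) : x ≠ 0 := by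
  rintro rfl
  simp [capCone] at hx

theorem mem_capCone_iff {a : E} {ρ : ℝ} (hρ : 0 < ρ) {x : E} :
    x ∈ capCone a ρ ↔ (‖x‖ < 1 ∧ 0 < ⟪x, a⟫) ∧ sinAngle a x < ρ := by
  rw [and_assoc]
  refine and_congr_right fun _ => ?_
  rcases eq_or_ne x 0 with rfl | hx
  · simp
  have hx0 : 0 < ‖x‖ := norm_pos_iff.2 hx
  have ht : ⟪‖x‖⁻¹ • x, a⟫ = ⟪x, a⟫ / ‖x‖ := by
    rw [real_inner_smul_left, inv_mul_eq_div]
  rw [sinAngle, Real.sqrt_lt' hρ, ht, ← lt_div_iff₀ hx0]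
  constructor
  · intro h
    have h0 : 0 < ⟪x, a⟫ / ‖x‖ := (Real.sqrt_nonneg _).trans_lt h
    refine ⟨(div_pos_iff_of_pos_right hx0).1 h0, ?_⟩
    rw [Real.sqrt_lt' h0] at h
    linarith
  · rintro ⟨h0, h⟩
    rw [Real.sqrt_lt' (div_pos h0 hx0)]
    linarith

theorem isOpen_capCone (a : E) (ρ : ℝ) : IsOpen (capCone a ρ) :=
  (isOpen_lt continuous_norm continuous_const).inter
    (isOpen_lt (continuous_const.mul continuous_norm) (continuous_id.inner continuous_const))

theorem isBounded_capCone (a : E) (ρ : ℝ) : Bornology.IsBounded (capCone a ρ) :=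
  Metric.isBounded_ball.subset fun _ hx => mem_ball_zero_iff.2 hx.1

theorem convex_capCone (a : E) (ρ : ℝ) : Convex ℝ (capCone a ρ) := by
  refine convex_iff_forall_pos.2 fun x hx y hy s t hs ht hst => ?_
  have h1 : ‖s • x + t • y‖ ≤ s * ‖x‖ + t * ‖y‖ := by
    refine (norm_add_le _ _).trans_eq ?_
    rw [norm_smul, norm_smul, Real.norm_of_nonneg hs.le, Real.norm_of_nonneg ht.le]
  have h2 := mul_lt_mul_of_pos_left hx.1 hs
  have h3 := mul_lt_mul_of_pos_left hy.1 ht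
  have h4 := mul_lt_mul_of_pos_left hx.2 hs
  have h5 := mul_lt_mul_of_pos_left hy.2 ht
  have h6 := mul_le_mul_of_nonneg_left h1 (Real.sqrt_nonneg (1 - ρ ^ 2))
  refine ⟨by linarith, ?_⟩
  rw [inner_add_left, real_inner_smul_left, real_inner_smul_left]
  linarith

theorem ball_subset_capCone {a : E} (ha : ‖a‖ = 1) {ρ : ℝ} (hρ0 : 0 < ρ) (hρ1 : ρ ≤ 1) :
    Metric.ball ((1 / 2 : ℝ) • a) (ρ / 2) ⊆ capCone a ρ := by
  intro y hy
  obtain ⟨v, rfl⟩ : ∃ v, y = (1 / 2 : ℝ) • a + v := ⟨y - (1 / 2 : ℝ) • a, by abel⟩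
  rw [mem_ball_iff_norm, add_sub_cancel_left] at hy
  have hva : |⟪v, a⟫| ≤ ‖v‖ := by simpa [ha] using abs_real_inner_le_norm v a
  have hv1 := neg_le_of_abs_le hva
  have hna : ‖(1 / 2 : ℝ) • a‖ = 1 / 2 := by rw [norm_smul, ha]; norm_num
  have hin : ⟪(1 / 2 : ℝ) • a + v, a⟫ = 1 / 2 + ⟪v, a⟫ := by
    rw [inner_add_left, real_inner_smul_left, real_inner_self_eq_norm_sq, ha]
    norm_num
  have hsq : ‖(1 / 2 : ℝ) • a + v‖ ^ 2 = 1 / 4 + ⟪v, a⟫ + ‖v‖ ^ 2 := by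
    rw [norm_add_sq_real, hna, real_inner_smul_left, real_inner_comm]
    ring
  refine ⟨by linarith [norm_add_le ((1 / 2 : ℝ) • a) v], ?_⟩
  rw [hin]
  refine lt_of_pow_lt_pow_left₀ 2 (by linarith) ?_
  rw [mul_pow, hsq, Real.sq_sqrt (by nlinarith)]
  have hv2 : ‖v‖ ^ 2 < ρ ^ 2 / 4 := by nlinarith [norm_nonneg v]
  rcases hρ1.lt_or_eq with h | rfl
  · have : 0 < (1 - ρ ^ 2) * (ρ ^ 2 / 4 - ‖v‖ ^ 2) :=
      mul_pos (by nlinarith) (by linarith)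
    nlinarith [sq_nonneg (⟪v, a⟫ + ρ ^ 2 / 2)]
  · have : 0 < 1 / 2 + ⟪v, a⟫ := by linarith
    nlinarith

open scoped Pointwise in
theorem infDist_inv_norm_smul {S : Set E} (hS : ∀ x ∈ S, ∀ c : ℝ, c • x ∈ S) {x : E} (hx : x ≠ 0) :
    Metric.infDist (‖x‖⁻¹ • x) S = ‖x‖⁻¹ * Metric.infDist x S := by
  have hc : ‖x‖⁻¹ ≠ 0 := inv_ne_zero (norm_ne_zero_iff.2 hx)
  have hSc : ‖x‖⁻¹ • S = S := by
    ext y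
    rw [Set.mem_smul_set_iff_inv_smul_mem₀ hc]
    refine ⟨fun h => ?_, fun h => hS y h _⟩
    simpa [smul_smul, norm_ne_zero_iff.2 hx] using hS _ h ‖x‖⁻¹
  conv_lhs => rw [← hSc]
  rw [infDist_smul₀ hc, norm_inv, norm_norm]

end ConeOverCap

section ConditionNumber

variable {n : ℕ}

theorem MvPolynomial.IsHomogeneous.exists_norm_eq_one_eval_ne_zero
    {P : MvPolynomial (Fin (n + 1)) ℝ} {k : ℕ} (hhom : P.IsHomogeneous k) (hP : P ≠ 0)
    (h0 : MvPolynomial.eval 0 P = 0) :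
    ∃ w : EuclideanSpace ℝ (Fin (n + 1)), ‖w‖ = 1 ∧ MvPolynomial.eval (fun i => w i) P ≠ 0 := by
  obtain ⟨v, hv⟩ : ∃ v, MvPolynomial.eval v P ≠ 0 := by
    by_contra! h
    exact hP (MvPolynomial.funext fun v => by rw [h v, map_zero])
  set u : EuclideanSpace ℝ (Fin (n + 1)) := WithLp.toLp 2 v with hu
  have hu0 : u ≠ 0 := by
    rintro h
    apply hv
    have : v = 0 := by simpa [hu] using h
    rw [this, h0]
  refine ⟨‖u‖⁻¹ • u, norm_smul_inv_norm (𝕜 := ℝ) hu0, ?_⟩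
  have := hhom.eval_smul_eq ‖u‖⁻¹ v
  simp only [PiLp.smul_apply, smul_eq_mul, hu] at this ⊢
  rw [this]
  exact mul_ne_zero (pow_ne_zero _ (inv_ne_zero (norm_ne_zero_iff.2 hu0))) hv

theorem setLIntegral_capCone_neg_log_infDist_le {d : ℕ} (hd : 1 ≤ d)
    {S : Set (EuclideanSpace ℝ (Fin (n + 1)))} (hSne : S.Nonempty) (hScl : IsClosed S)
    (hScone : ∀ x ∈ S, ∀ c : ℝ, c • x ∈ S)
    {P : MvPolynomial (Fin (n + 1)) ℝ} (hP : P ≠ 0)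
    {k : ℕ} (hk : k ≤ d) (hhom : P.IsHomogeneous k)
    (hSP : ∀ x ∈ S, MvPolynomial.eval (fun i => x i) P = 0)
    {a : EuclideanSpace ℝ (Fin (n + 1))} (ha : ‖a‖ = 1) {ρ : ℝ} (hρ0 : 0 < ρ) (hρ1 : ρ ≤ 1) :
    ∫⁻ x in capCone a ρ, ENNReal.ofReal (-Real.log (Metric.infDist (‖x‖⁻¹ • x) S)) ≤
      volume (capCone a ρ) * ENNReal.ofReal (Real.log (16 / 7) + 3 / 2 * Real.log (n + 1) +
        Real.log d + 9 / 5 + Real.log (1 / ρ)) := by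
  have hev : ∀ x : EuclideanSpace ℝ (Fin (n + 1)),
      MvPolynomial.eval (fun i => (x i : ℂ)) (MvPolynomial.map (algebraMap ℝ ℂ) P) =
        (MvPolynomial.eval (fun i => x i) P : ℝ) := by
    intro x
    rw [MvPolynomial.eval_map]
    exact (MvPolynomial.eval₂_comp_left (algebraMap ℝ ℂ) (RingHom.id ℝ) (fun i => x i) P).symm
  obtain ⟨x₀, hx₀⟩ := hSne
  have h0 : MvPolynomial.eval 0 P = 0 := by
    have := hSP _ (hScone x₀ hx₀ 0)
    simpa [Pi.zero_def] using this
  obtain ⟨w, hw1, hw⟩ := hhom.exists_norm_eq_one_eval_ne_zero hP h0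
  have hd0 : (0 : ℝ) < d := by exact_mod_cast hd
  have hmain := setLIntegral_neg_log_infDist_le (Q := MvPolynomial.map (algebraMap ℝ ℂ) P)
    (S := S) (K := capCone a ρ) (Nat.zero_lt_of_lt hd)
    ((hhom.map (algebraMap ℝ ℂ)).totalDegree_le.trans hk)
    (hhom.map _) hw1 (by rw [hev]; exact_mod_cast hw) hScl ⟨x₀, hx₀⟩
    (fun y hy => by rw [hev, hSP y hy, Complex.ofReal_zero]) (convex_capCone a ρ)
    (isOpen_capCone a ρ) (isBounded_capCone a ρ) (half_pos hρ0) (ball_subset_capCone ha hρ0 hρ1)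
  have hlog1 : 0 ≤ Real.log (1 / ρ) := Real.log_nonneg (by rw [le_div_iff₀ hρ0]; linarith)
  have hlogd : 0 ≤ Real.log d := Real.log_nonneg (by exact_mod_cast hd)
  have hlogn : 0 ≤ Real.log (n + 1) := Real.log_nonneg (by linarith [n.cast_nonneg (α := ℝ)])
  have hlogc : 0 ≤ Real.log (16 / 7) := Real.log_nonneg (by norm_num)
  have hn0 : (0 : ℝ) < n + 1 := by positivity
  have hsplit : Real.log (8 * ((n + 1 : ℕ) : ℝ) * d / (7 * (ρ / 2))) =
      Real.log (16 / 7) + Real.log (n + 1) + Real.log d + Real.log (1 / ρ) := by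
    rw [← Real.log_mul (by norm_num) hn0.ne', ← Real.log_mul (by positivity) hd0.ne',
      ← Real.log_mul (by positivity) (by positivity)]
    congr 1
    push_cast
    field_simp
    norm_num
  refine le_trans (setLIntegral_mono' (isOpen_capCone a ρ).measurableSet fun x hx => ?_)
    (hmain.trans (mul_le_mul_right ?_ _))
  · have hx0 := norm_pos_iff.2 (ne_zero_of_mem_capCone hx)
    refine ENNReal.ofReal_le_ofReal (neg_le_neg ?_)
    rw [infDist_inv_norm_smul hScone (ne_zero_of_mem_capCone hx)]
    rcases (Metric.infDist_nonneg (x := x) (s := S)).eq_or_lt with h | h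
    · simp [← h]
    · exact Real.log_le_log h (le_mul_of_one_le_left h.le ((one_le_inv₀ hx0).2 hx.1.le))
  · rw [hsplit, ← ENNReal.ofReal_one, ← ENNReal.ofReal_add zero_le_one
      (by push_cast; linarith)]
    refine ENNReal.ofReal_le_ofReal ?_
    push_cast
    linarith

end ConditionNumber

section ConeMeasure

variable {n : ℕ} {a : EuclideanSpace ℝ (Fin (n + 1))}

theorem lintegral_nuMeasure_le (hn : 1 ≤ n) (a : EuclideanSpace ℝ (Fin (n + 1))) (σ : ℝ)
    {G : EuclideanSpace ℝ (Fin (n + 1)) → ℝ≥0∞} (hG : Measurable G) :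
    ∫⁻ z, G z ∂(nuMeasure n a σ) ≤
      (volume (capCone a σ))⁻¹ * ∫⁻ x in capCone a σ, G (‖x‖⁻¹ • x) := by
  have : NeZero n := ⟨by omega⟩
  set U : Set (EuclideanSpace ℝ (Fin (n + 1))) := {z | √(1 - σ ^ 2) < ⟪z, a⟫} with hU
  have hUo : IsOpen U := isOpen_lt continuous_const (continuous_id.inner continuous_const)
  have hcap : cap n a σ = Metric.sphere 0 1 ∩ U := rfl
  have hpre : (fun x : EuclideanSpace ℝ (Fin (n + 1)) => ‖x‖⁻¹ • x) ⁻¹' (Metric.sphere 0 1 ∩ U) ∩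
      Metric.ball 0 1 = capCone a σ := by
    ext x
    rcases eq_or_ne x 0 with rfl | hx
    · simp [capCone]
    have hx0 : 0 < ‖x‖ := norm_pos_iff.2 hx
    simp only [Set.mem_inter_iff, Set.mem_preimage, mem_sphere_zero_iff_norm,
      mem_ball_zero_iff, capCone, hU, Set.mem_ofPred_eq, norm_smul,
      norm_inv, norm_norm, inv_mul_cancel₀ hx0.ne', real_inner_smul_left, inv_mul_eq_div,
      lt_div_iff₀ hx0, true_and, and_comm]
  have hm : MeasurableSet (Metric.sphere (0 : EuclideanSpace ℝ (Fin (n + 1))) 1 ∩ U) :=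
    Metric.isClosed_sphere.measurableSet.inter hUo.measurableSet
  rw [nuMeasure, hcap]
  by_cases h0 : μH[(n : ℝ)] (Metric.sphere 0 1 ∩ U) = 0
  · rw [Measure.restrict_eq_zero.2 h0, smul_zero, lintegral_zero_measure]
    exact zero_le
  by_cases ht : μH[(n : ℝ)] (Metric.sphere 0 1 ∩ U) = ∞
  · rw [ht, ENNReal.inv_top, zero_smul, lintegral_zero_measure]
    exact zero_le
  rw [normalized_hausdorffMeasure_eq hUo h0 ht, lintegral_smul_measure, directionMeasure_apply hm,
    hpre, directionMeasure, setLIntegral_map hm hG measurable_inv_norm_smul,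
    Measure.restrict_restrict (measurable_inv_norm_smul hm), hpre, smul_eq_mul]

theorem measurable_sinAngle : Measurable (sinAngle a) := by
  unfold sinAngle
  fun_prop

theorem volume_halfBall_sinAngle_eq (hn : 1 ≤ n) (ha : ‖a‖ = 1) (ρ : ℝ) :
    (volume.restrict {x | ‖x‖ < 1 ∧ 0 < ⟪x, a⟫}) (sinAngle a ⁻¹' {ρ}) = 0 := by
  obtain ⟨C, -, -, hC⟩ := exists_lintegral_cone_eq hn ha
  have h1 := hC (({ρ} : Set ℝ).indicator 1) (measurable_one.indicator (measurableSet_singleton ρ))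
  have h2 : ∀ x, ({ρ} : Set ℝ).indicator (1 : ℝ → ℝ≥0∞) (√(1 - ⟪‖x‖⁻¹ • x, a⟫ ^ 2)) =
      (sinAngle a ⁻¹' {ρ}).indicator 1 x := fun x => rfl
  simp only [h2] at h1
  rw [lintegral_indicator_one (measurable_sinAngle (measurableSet_singleton ρ))] at h1
  rw [h1]
  refine mul_eq_zero_of_right _ ?_
  refine lintegral_eq_zero_of_ae_eq_zero ?_
  filter_upwards [ae_restrict_of_ae (measure_eq_zero_iff_ae_notMem.1 (measure_singleton ρ))] with r hr
  rw [Set.indicator_of_notMem hr, mul_zero, Pi.zero_apply]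

theorem restrict_capCone_eq (hn : 1 ≤ n) (ha : ‖a‖ = 1) {ρ : ℝ} (hρ : 0 < ρ) :
    volume.restrict (capCone a ρ) =
      (volume.restrict {x | ‖x‖ < 1 ∧ 0 < ⟪x, a⟫}).restrict (sinAngle a ⁻¹' Set.Ioo 0 ρ) := by
  have h1 : capCone a ρ = sinAngle a ⁻¹' Set.Iio ρ ∩ {x | ‖x‖ < 1 ∧ 0 < ⟪x, a⟫} := by
    ext x
    rw [mem_capCone_iff hρ, and_comm]
    rfl
  rw [h1, ← Measure.restrict_restrict (measurable_sinAngle measurableSet_Iio)]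
  refine Measure.restrict_congr_set (Filter.eventuallyEq_set.2 ?_)
  filter_upwards [measure_eq_zero_iff_ae_notMem.1 (volume_halfBall_sinAngle_eq hn ha 0)] with x hx
  have : 0 < sinAngle a x := lt_of_le_of_ne (Real.sqrt_nonneg _) (Ne.symm hx)
  exact ⟨fun h => ⟨this, h⟩, fun h => h.2⟩

theorem setLIntegral_capCone_comp_sinAngle (hn : 1 ≤ n) (ha : ‖a‖ = 1) :
    ∃ C : ℝ≥0∞, C ≠ 0 ∧ C ≠ ∞ ∧ ∀ ρ ∈ Set.Ioc (0 : ℝ) 1, ∀ G : ℝ → ℝ≥0∞, Measurable G →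
      ∫⁻ x in capCone a ρ, G (sinAngle a x) =
        C * ∫⁻ r in Set.Ioo 0 ρ, ENNReal.ofReal (r ^ (n - 1) / √(1 - r ^ 2)) * G r := by
  obtain ⟨C, hC0, hCt, hC⟩ := exists_lintegral_cone_eq hn ha
  refine ⟨C, hC0, hCt, fun ρ hρ G hG => ?_⟩
  rw [restrict_capCone_eq hn ha hρ.1,
    ← lintegral_indicator (measurable_sinAngle measurableSet_Ioo)]
  have h1 := hC ((Set.Ioo 0 ρ).indicator G) (hG.indicator measurableSet_Ioo)
  refine h1.trans ?_
  congr 1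
  have h2 : ∀ r, ENNReal.ofReal (r ^ (n - 1) / √(1 - r ^ 2)) * (Set.Ioo 0 ρ).indicator G r =
      (Set.Ioo 0 ρ).indicator
        (fun r => ENNReal.ofReal (r ^ (n - 1) / √(1 - r ^ 2)) * G r) r := fun r => by
    by_cases hr : r ∈ Set.Ioo 0 ρ <;> simp only [hr, Set.indicator_of_mem,
      Set.indicator_of_notMem, not_false_eq_true, mul_zero]
  simp only [h2]
  rw [setLIntegral_indicator measurableSet_Ioo,
    Set.inter_eq_left.2 (Set.Ioo_subset_Ioo_right hρ.2)]

theorem setLIntegral_map_withDensity_eq (hn : 1 ≤ n) (ha : ‖a‖ = 1) {ρ : ℝ} (hρ : 0 < ρ)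
    {F : EuclideanSpace ℝ (Fin (n + 1)) → ℝ≥0∞} (hF : Measurable F) {φ : ℝ → ℝ≥0∞}
    (hφ : Measurable φ) :
    ∫⁻ r in Set.Ioo 0 ρ, φ r
        ∂(((volume.restrict {x | ‖x‖ < 1 ∧ 0 < ⟪x, a⟫}).withDensity F).map (sinAngle a)) =
      ∫⁻ x in capCone a ρ, F x * φ (sinAngle a x) := by
  rw [setLIntegral_map measurableSet_Ioo hφ measurable_sinAngle,
    setLIntegral_withDensity_eq_setLIntegral_mul _ hF
      (g := fun x => φ (sinAngle a x)) (hφ.comp measurable_sinAngle)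
      (measurable_sinAngle measurableSet_Ioo), restrict_capCone_eq hn ha hρ]
  rfl

/-- If the mean of `F` over each cone is controlled by an antitone function of its opening, so is
the mean of `F` against an antitone weight. -/
theorem setLIntegral_capCone_mul_le (hn : 1 ≤ n) (ha : ‖a‖ = 1) {σ : ℝ} (hσ : 0 < σ)
    {F : EuclideanSpace ℝ (Fin (n + 1)) → ℝ≥0∞} (hF : Measurable F)
    {b : ℝ → ℝ≥0∞} (hb : Measurable b) (hba : AntitoneOn b (Set.Ioc 0 σ))
    (hFb : ∀ ρ ∈ Set.Ioc 0 σ, ∫⁻ x in capCone a ρ, F x ≤ volume (capCone a ρ) * b ρ)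
    {g : ℝ → ℝ} (hg : Measurable g) (hga : AntitoneOn g (Set.Ioc 0 σ))
    (hg0 : ∀ r ∈ Set.Ioo 0 σ, 0 ≤ g r) :
    ∫⁻ x in capCone a σ, F x * ENNReal.ofReal (g (sinAngle a x)) ≤
      ∫⁻ x in capCone a σ, b (sinAngle a x) * ENNReal.ofReal (g (sinAngle a x)) := by
  have hbs : Measurable fun x => b (sinAngle a x) := hb.comp measurable_sinAngle
  rw [← setLIntegral_map_withDensity_eq hn ha hσ hF hg.ennreal_ofReal,
    ← setLIntegral_map_withDensity_eq hn ha hσ hbs hg.ennreal_ofReal]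
  have hone : ∀ (ρ : ℝ), 0 < ρ → ∀ f : EuclideanSpace ℝ (Fin (n + 1)) → ℝ≥0∞, Measurable f →
      (((volume.restrict {x | ‖x‖ < 1 ∧ 0 < ⟪x, a⟫}).withDensity f).map (sinAngle a))
        (Set.Ioo 0 ρ) = ∫⁻ x in capCone a ρ, f x := by
    intro ρ hρ f hf
    have := setLIntegral_map_withDensity_eq hn ha hρ hf (φ := fun _ => 1) measurable_const
    simpa using this
  refine setLIntegral_le_of_antitoneOn (fun ρ hρ => ?_) (fun ρ => ?_) hga hg0
  · rw [hone ρ hρ.1 F hF, hone ρ hρ.1 _ hbs]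
    refine (hFb ρ hρ).trans ?_
    rw [mul_comm, ← setLIntegral_const]
    refine lintegral_mono_ae ?_
    rw [restrict_capCone_eq hn ha hρ.1]
    filter_upwards [ae_restrict_mem (measurable_sinAngle measurableSet_Ioo)] with x hx
    exact hba ⟨hx.1, hx.2.le.trans hρ.2⟩ hρ hx.2.le
  · rw [Measure.map_apply measurable_sinAngle (measurableSet_singleton ρ)]
    exact withDensity_absolutelyContinuous _ _ (volume_halfBall_sinAngle_eq hn ha ρ)

end ConeMeasure

section Constants

theorem Real.two_add_log_four_div_pi_le {x : ℝ} (hx : 1 ≤ x) :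
    2 + Real.log (4 / Real.pi) ≤ Real.log (2 * Real.exp 1 * x / Real.log (Real.pi * x / 2)) := by
  have hπ := Real.pi_gt_three
  have hy : 0 < Real.pi * x / 2 := by positivity
  have hlog : 0 < Real.log (Real.pi * x / 2) := Real.log_pos (by nlinarith)
  have hle : Real.log (Real.pi * x / 2) ≤ Real.pi * x / 2 / Real.exp 1 := by
    have := Real.add_one_le_exp (Real.log (Real.pi * x / 2) - 1)
    rw [Real.exp_sub, Real.exp_log hy] at this
    linarith
  have h2 : 2 + Real.log (4 / Real.pi) = Real.log (2 * Real.exp 1 * x / (Real.pi * x / 2 / Real.exp 1)) := by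
    rw [show 2 * Real.exp 1 * x / (Real.pi * x / 2 / Real.exp 1) = Real.exp 2 * (4 / Real.pi) by
      rw [show (2 : ℝ) = 1 + 1 by norm_num, Real.exp_add]; field_simp; norm_num,
      Real.log_mul (by positivity) (by positivity), Real.log_exp]
  rw [h2]
  exact Real.log_le_log (by positivity) (by gcongr)

theorem log_constants_le {n : ℕ} (hn : 1 ≤ n) {β H : ℝ} (hβ0 : 0 ≤ β) (hβn : β < n) (hH : 1 ≤ H) :
    Real.log (16 / 7) + 3 / 2 * Real.log (n + 1) + 9 / 5 + 2 / (n - β) * Real.log (2 * H) ≤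
      2 * Real.log n + Real.log (13 * Real.pi / 2) + (1 / (1 - β / n)) *
        Real.log (2 * Real.exp 1 * H ^ 2 * n / Real.log (Real.pi * n / 2)) := by
  have hn1 : (1 : ℝ) ≤ n := by exact_mod_cast hn
  have hn0 : (0 : ℝ) < n := by linarith
  have hπ := Real.pi_pos
  have hm : 0 < (n : ℝ) - β := by linarith
  have hlogn : 0 ≤ Real.log n := Real.log_nonneg hn1
  have hlogH : 0 ≤ Real.log H := Real.log_nonneg hH
  have hlog2 := Real.log_two_lt_d9
  have hlog2' := Real.log_two_gt_d9
  have hloglog : 0 < Real.log (Real.pi * n / 2) :=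
    Real.log_pos (by nlinarith [Real.pi_gt_three])
  set L := Real.log (2 * Real.exp 1 * n / Real.log (Real.pi * n / 2)) with hL
  have hLge : 2 + Real.log (4 / Real.pi) ≤ L := Real.two_add_log_four_div_pi_le hn1
  have hpi4 : 0 ≤ Real.log (4 / Real.pi) :=
    Real.log_nonneg (by rw [le_div_iff₀ hπ]; linarith [Real.pi_lt_four])
  have hLH : Real.log (2 * Real.exp 1 * H ^ 2 * n / Real.log (Real.pi * n / 2)) =
      L + 2 * Real.log H := by
    rw [hL, show 2 * Real.exp 1 * H ^ 2 * n / Real.log (Real.pi * n / 2) =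
      2 * Real.exp 1 * n / Real.log (Real.pi * n / 2) * H ^ 2 by ring,
      Real.log_mul (by positivity) (by positivity), Real.log_pow]
    norm_num
  set T := 1 / (1 - β / n) with hT
  have hT' : T = n / (n - β) := by
    rw [hT]
    field_simp
  have hT1 : 1 ≤ T := by
    rw [hT', le_div_iff₀ hm]
    linarith
  have hTn : 2 / (n - β) = T * (2 / n) := by
    rw [hT']
    field_simp
  have h26 : Real.log (16 / 7) + 7 / 2 * Real.log 2 ≤ Real.log 26 := by
    have h : Real.log ((16 / 7) ^ 2 * 2 ^ 7) ≤ Real.log (26 ^ 2) :=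
      Real.log_le_log (by norm_num) (by norm_num)
    rw [Real.log_mul (by norm_num) (by norm_num), Real.log_pow, Real.log_pow, Real.log_pow] at h
    push_cast at h
    linarith
  have hsum : Real.log (13 * Real.pi / 2) + Real.log (4 / Real.pi) = Real.log 26 := by
    rw [← Real.log_mul (by positivity) (by positivity)]
    congr 1
    field_simp
    norm_num
  have hnp : Real.log (n + 1) ≤ Real.log n + Real.log 2 := by
    rw [← Real.log_mul hn0.ne' two_ne_zero]
    exact Real.log_le_log (by linarith) (by linarith)
  have h2n : 2 / (n : ℝ) ≤ 2 := div_le_self zero_le_two hn1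
  have hA : (2 / (n : ℝ)) * Real.log 2 ≤ 2 * Real.log 2 := by gcongr
  have hB : (2 / (n : ℝ)) * Real.log H ≤ 2 * Real.log H := by gcongr
  rw [hLH, hTn, Real.log_mul two_ne_zero (by linarith)]
  have hC : L - 2 / n * Real.log 2 ≤ T * (L + 2 * Real.log H - 2 / n * (Real.log 2 + Real.log H)) :=
    calc L - 2 / n * Real.log 2 ≤ L + 2 * Real.log H - 2 / n * (Real.log 2 + Real.log H) := by
          linarith
      _ ≤ _ := le_mul_of_one_le_left (by linarith) hT1
  linarith

end Constants

/-- Smoothed analysis for adversarial distributions: for `z ∈ Sⁿ` one has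
`ln C(z) = -ln dist(z,S)` (nonnegative, since `C(z) ≥ 1`), and its expectation
with respect to the adversarial measure `μ` (as a lower Lebesgue integral) is
at most `2 ln n + ln d + ln(1/σ) + ln(13π/2) + (1/(1-β/n))·ln(2eH²n/ln(πn/2))`. -/
theorem stmt19 (n d : ℕ) (hn : 1 ≤ n) (hd : 1 ≤ d)
    (S : Set (EuclideanSpace ℝ (Fin (n + 1)))) (hSne : S.Nonempty) (hScl : IsClosed S)
    (hScone : ∀ x ∈ S, ∀ lam : ℝ, lam • x ∈ S)
    (P : MvPolynomial (Fin (n + 1)) ℝ) (hP : P ≠ 0)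
    (k : ℕ) (hk : k ≤ d) (hhom : P.IsHomogeneous k)
    (hSP : ∀ x ∈ S, MvPolynomial.eval (fun i => x i) P = 0)
    (σ : ℝ) (hσ : σ ∈ Set.Ioc (0:ℝ) 1)
    (a : EuclideanSpace ℝ (Fin (n + 1)))
    (ha : a ∈ Metric.sphere (0 : EuclideanSpace ℝ (Fin (n + 1))) 1)
    (β : ℝ) (hβ0 : 0 ≤ β) (hβn : β < n)
    (h : ℝ → ℝ) (hcont : ContinuousOn h (Set.Icc 0 σ))
    (hpos : ∀ r ∈ Set.Icc (0:ℝ) σ, 0 < h r)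
    (hint : (∫ r in (0:ℝ)..σ, h r * (r ^ ((n : ℝ) - β - 1) / Real.sqrt (1 - r ^ 2)))
      = Ifun ((n : ℝ) - β) σ)
    (hmono : AntitoneOn (gFun n σ β h) (Set.Ioc 0 σ))
    (H : ℝ) (hH : H = sSup (h '' Set.Icc 0 σ)) :
    ∫⁻ z, ENNReal.ofReal (-Real.log (Metric.infDist z S)) ∂(advMeasure n a σ β h) ≤
      ENNReal.ofReal (2 * Real.log n + Real.log d + Real.log (1 / σ) +
        Real.log (13 * Real.pi / 2) +
        (1 / (1 - β / n)) *
          Real.log (2 * Real.exp 1 * H ^ 2 * n / Real.log (Real.pi * n / 2))) := by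
  obtain ⟨hσ0, hσ1⟩ := hσ
  have ha1 : ‖a‖ = 1 := mem_sphere_zero_iff_norm.1 ha
  have hm : 0 < (n : ℝ) - β := by linarith
  have hn0 : (0 : ℝ) < n := by exact_mod_cast hn
  have hIn := Ifun_pos hn0 hσ0 hσ1
  have hIm := Ifun_pos hm hσ0 hσ1
  have hhH : ∀ r ∈ Set.Ioo 0 σ, h r ≤ H := fun r hr => by
    rw [hH]
    exact le_csSup (isCompact_Icc.image_of_continuousOn hcont).bddAbove
      ⟨r, Set.Ioo_subset_Icc_self hr, rfl⟩
  have hH1 := one_le_of_integral_eq_Ifun hm hσ0 hσ1 hhH hint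
  set A := Real.log (16 / 7) + 3 / 2 * Real.log (n + 1) + Real.log d + 9 / 5 with hA
  have hA0 : 0 ≤ A := by
    have h1 : 0 ≤ Real.log (16 / 7) := Real.log_nonneg (by norm_num)
    have h2 : 0 ≤ Real.log ((n : ℝ) + 1) := Real.log_nonneg (by linarith)
    have h3 : 0 ≤ Real.log d := Real.log_nonneg (by exact_mod_cast hd)
    linarith
  set h' : ℝ → ℝ := Set.IccExtend hσ0.le ((Set.Icc 0 σ).domRestrict h) with hh'
  have hh'c : Measurable h' :=
    (continuousOn_iff_continuous_domRestrict.1 hcont).Icc_extend'.measurable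
  have hh'e : ∀ r ∈ Set.Icc 0 σ, h' r = h r := fun r hr => by
    rw [hh', Set.IccExtend_of_mem _ _ hr]; rfl
  set g := gFun n σ β h' with hg
  have hgm : Measurable g := by
    have : Measurable fun r : ℝ => r ^ (-β) := measurable_id.pow_const _
    exact (this.const_mul _).mul hh'c
  have hge : ∀ r ∈ Set.Icc 0 σ, g r = gFun n σ β h r := fun r hr => by
    rw [hg, gFun, gFun, hh'e r hr]
  have hga : AntitoneOn g (Set.Ioc 0 σ) :=
    hmono.congr fun r hr => (hge r (Set.Ioc_subset_Icc_self hr)).symm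
  have hg0 : ∀ r ∈ Set.Ioo 0 σ, 0 ≤ g r := fun r hr => by
    have h1 := hpos r (Set.Ioo_subset_Icc_self hr)
    have h2 := hr.1
    rw [hge r (Set.Ioo_subset_Icc_self hr), gFun]
    positivity
  set F : EuclideanSpace ℝ (Fin (n + 1)) → ℝ≥0∞ :=
    fun z => ENNReal.ofReal (-Real.log (Metric.infDist z S)) with hF
  have hFm : Measurable F := by
    have : Measurable fun z : EuclideanSpace ℝ (Fin (n + 1)) => Metric.infDist z S :=
      (Metric.continuous_infDist_pt S).measurable
    fun_prop
  have hadv : advMeasure n a σ β h = (nuMeasure n a σ).withDensity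
      (fun z => ENNReal.ofReal (g (√(1 - ⟪z, a⟫ ^ 2)))) := by
    refine withDensity_congr_ae (Measure.ae_smul_measure ?_ _)
    have hU : IsOpen {z : EuclideanSpace ℝ (Fin (n + 1)) | √(1 - σ ^ 2) < ⟪z, a⟫} :=
      isOpen_lt continuous_const (continuous_id.inner continuous_const)
    filter_upwards [ae_restrict_mem (Metric.isClosed_sphere.measurableSet.inter hU.measurableSet)]
      with z hz
    rw [hge]
    refine ⟨Real.sqrt_nonneg _, Real.sqrt_le_iff.2 ⟨hσ0.le, ?_⟩⟩
    have := (Real.sqrt_lt' ((Real.sqrt_nonneg _).trans_lt hz.2)).1 hz.2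
    linarith
  have hgz : Measurable fun z : EuclideanSpace ℝ (Fin (n + 1)) =>
      ENNReal.ofReal (g (√(1 - ⟪z, a⟫ ^ 2))) :=
    (hgm.comp (by fun_prop)).ennreal_ofReal
  have hFn : Measurable fun x : EuclideanSpace ℝ (Fin (n + 1)) => F (‖x‖⁻¹ • x) :=
    hFm.comp measurable_inv_norm_smul
  set b : ℝ → ℝ≥0∞ := fun r => ENNReal.ofReal (A + Real.log (1 / r)) with hb
  have hbm : Measurable b := by fun_prop
  have hba : AntitoneOn b (Set.Ioc 0 σ) := fun r hr s hs hrs => by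
    have := hr.1
    have := hs.1
    refine ENNReal.ofReal_le_ofReal (add_le_add_right ?_ A)
    exact Real.log_le_log (by positivity) (by gcongr)
  have hkey := setLIntegral_capCone_mul_le hn ha1 hσ0 hFn hbm hba
    (fun ρ hρ => setLIntegral_capCone_neg_log_infDist_le hd hSne hScl hScone hP hk hhom hSP ha1
      hρ.1 (hρ.2.trans hσ1)) hgm hga hg0
  obtain ⟨C, hC0, hCt, hC⟩ := setLIntegral_capCone_comp_sinAngle hn ha1
  have hpow : ∀ r ∈ Set.Ioo 0 σ, r ^ (n - 1) = r ^ ((n : ℝ) - 1) := fun r hr => by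
    rw [← Real.rpow_natCast, Nat.cast_sub hn, Nat.cast_one]
  have hvol : volume (capCone a σ) = C * ENNReal.ofReal (Ifun n σ) := by
    have h1 := hC σ ⟨hσ0, hσ1⟩ (fun _ => 1) measurable_const
    simp only [mul_one, setLIntegral_const, one_mul] at h1
    rw [h1, Ifun, intervalIntegral.integral_of_le hσ0.le, integral_Ioc_eq_integral_Ioo,
      ofReal_integral_eq_lintegral_ofReal]
    · congr 1
      exact setLIntegral_congr_fun measurableSet_Ioo fun r hr => by rw [hpow r hr]
    · exact (intervalIntegrable_iff_integrableOn_Ioo_of_le hσ0.le).1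
        (intervalIntegrable_rpow_div_sqrt hn0 hσ0.le hσ1)
    · filter_upwards [ae_restrict_mem measurableSet_Ioo] with r hr
      exact div_nonneg (Real.rpow_nonneg hr.1.le _) (Real.sqrt_nonneg _)
  have hright : ∫⁻ x in capCone a σ, b (sinAngle a x) * ENNReal.ofReal (g (sinAngle a x)) ≤
      volume (capCone a σ) *
        ENNReal.ofReal (A + Real.log (1 / σ) + 2 / (n - β) * Real.log (2 * H)) := by
    rw [hC σ ⟨hσ0, hσ1⟩ (fun r => b r * ENNReal.ofReal (g r)) (hbm.mul hgm.ennreal_ofReal), hvol,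
      mul_assoc]
    refine mul_le_mul_right ?_ C
    calc _ = ∫⁻ r in Set.Ioo 0 σ, ENNReal.ofReal (Ifun n σ / Ifun (n - β) σ) *
          (ENNReal.ofReal (h r * (r ^ ((n : ℝ) - β - 1) / √(1 - r ^ 2))) * b r) := by
          refine setLIntegral_congr_fun measurableSet_Ioo fun r hr => ?_
          have hr0 := hr.1
          have h1 := hpos r (Set.Ioo_subset_Icc_self hr)
          have h2 : r ^ ((n : ℝ) - β - 1) = r ^ ((n : ℝ) - 1) * r ^ (-β) := by
            rw [← Real.rpow_add hr0]
            ring_nf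
          have h3 : 0 ≤ r ^ (n - 1) / √(1 - r ^ 2) := by positivity
          have h4 : 0 ≤ Ifun n σ / Ifun (n - β) σ := by positivity
          have h5 : r ^ (n - 1) / √(1 - r ^ 2) * g r = Ifun n σ / Ifun (n - β) σ *
              (h r * (r ^ ((n : ℝ) - β - 1) / √(1 - r ^ 2))) := by
            rw [hge r (Set.Ioo_subset_Icc_self hr), gFun, hpow r hr, h2]
            ring
          change _ * (b r * _) = _
          rw [mul_comm (b r), ← mul_assoc, ← mul_assoc, ← ENNReal.ofReal_mul h3, h5,
            ENNReal.ofReal_mul h4]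
      _ = ENNReal.ofReal (Ifun n σ / Ifun (n - β) σ) * ∫⁻ r in Set.Ioo 0 σ,
          ENNReal.ofReal (h r * (r ^ ((n : ℝ) - β - 1) / √(1 - r ^ 2))) * b r :=
          lintegral_const_mul' _ _ ENNReal.ofReal_ne_top
      _ ≤ ENNReal.ofReal (Ifun n σ / Ifun (n - β) σ) * (ENNReal.ofReal (Ifun (n - β) σ) *
          ENNReal.ofReal (A + Real.log (1 / σ) + 2 / (n - β) * Real.log (2 * H))) :=
          mul_le_mul_right (setLIntegral_log_le hm hσ0 hσ1 hA0
            (fun r hr => (hpos r (Set.Ioo_subset_Icc_self hr)).le) hhH hint) _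
      _ = _ := by
          rw [← mul_assoc, ← ENNReal.ofReal_mul (by positivity), div_mul_cancel₀ _ hIm.ne']
  have hv0 : volume (capCone a σ) ≠ 0 := by
    rw [hvol]
    exact mul_ne_zero hC0 (ENNReal.ofReal_pos.2 hIn).ne'
  have hvt : volume (capCone a σ) ≠ ∞ := (isBounded_capCone a σ).measure_lt_top.ne
  calc ∫⁻ z, F z ∂(advMeasure n a σ β h)
      = ∫⁻ z, F z * ENNReal.ofReal (g (√(1 - ⟪z, a⟫ ^ 2))) ∂(nuMeasure n a σ) := by
        rw [hadv, lintegral_withDensity_eq_lintegral_mul _ hgz hFm]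
        exact lintegral_congr fun z => mul_comm (ENNReal.ofReal _) (F z)
    _ ≤ (volume (capCone a σ))⁻¹ * ∫⁻ x in capCone a σ,
          F (‖x‖⁻¹ • x) * ENNReal.ofReal (g (sinAngle a x)) :=
        lintegral_nuMeasure_le hn a σ (hFm.mul hgz)
    _ ≤ (volume (capCone a σ))⁻¹ * (volume (capCone a σ) *
          ENNReal.ofReal (A + Real.log (1 / σ) + 2 / (n - β) * Real.log (2 * H))) :=
        mul_le_mul_right (hkey.trans hright) _
    _ = ENNReal.ofReal (A + Real.log (1 / σ) + 2 / (n - β) * Real.log (2 * H)) := by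
        rw [← mul_assoc, ENNReal.inv_mul_cancel hv0 hvt, one_mul]
    _ ≤ _ := by
        refine ENNReal.ofReal_le_ofReal ?_
        have := log_constants_le hn hβ0 hβn hH1
        linarith
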